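/- arXiv:2510.15008 — 2 statements merged into one kernel-verified Lean document; each statement's English description precedes it below -/
import Mathlib

section
/- ∫_0^{π/2} x ln^3(sin(x)) dx = −(93/128)ζ(5) − (9/8)ζ(2)ζ(3) + 3 Li_5(1/2) + (57/32) ln(2) ζ(4) − (1/2) ln^3(2) ζ(2) − (1/40) ln^5(2). -/
open Real

/-- Riemann zeta value at a positive integer `m > 1`, as the series `∑ 1/n^m`. -/
noncomputable def zetaVal (m : ℕ) : ℝ := ∑' n : ℕ, 1 / (n + 1 : ℝ) ^ m

/-- Polylogarithm `Li_m(z) = ∑_{k≥1} z^k / k^m`. -/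
noncomputable def polyLog (m : ℕ) (z : ℝ) : ℝ := ∑' k : ℕ, z ^ (k + 1) / (k + 1 : ℝ) ^ m

/-- Generalized harmonic number `H_k^{(m)} = ∑_{n=1}^k 1/n^m`. -/
noncomputable def genHarmonic (k m : ℕ) : ℝ := ∑ n ∈ Finset.range k, 1 / (n + 1 : ℝ) ^ m

namespace LogSin
open Real Set Filter Topology MeasureTheory



noncomputable def hh (v : ℝ) : ℝ := Real.log (1 + Real.exp (-2 * v))
noncomputable def kk (v : ℝ) : ℝ := Real.log (1 - Real.exp (-2 * v))
noncomputable def LL (x : ℝ) : ℝ := Real.log (2 * Real.sin x)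
noncomputable def HH (b n : ℕ) : ℝ := ∫ v in Ioi (0 : ℝ), v ^ b * (hh v) ^ n
noncomputable def KK (b n : ℕ) : ℝ := ∫ v in Ioi (0 : ℝ), v ^ b * (kk v) ^ n
noncomputable def SS (b n : ℕ) : ℝ := ∫ x in (0 : ℝ)..(π / 2), x ^ b * (LL x) ^ n
noncomputable def hC (w : ℂ) : ℂ := Complex.log (1 - Complex.exp (2 * Complex.I * w))

lemma phi_aux (n : ℕ) : ∀ ε : ℝ, 0 < ε →
    Tendsto (fun y : ℝ => y ^ ε * (|Real.log y| + π) ^ n) (𝓝[>] 0) (𝓝 0) := by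
  have h0 : ∀ ε : ℝ, 0 < ε → Tendsto (fun y : ℝ => y ^ ε) (𝓝[>] 0) (𝓝 0) := by
    intro ε hε
    have := (Real.continuousAt_rpow_const 0 ε (Or.inr hε.le)).tendsto
    rw [Real.zero_rpow hε.ne'] at this
    exact this.mono_left nhdsWithin_le_nhds
  induction n with
  | zero => intro ε hε; simpa using h0 ε hε
  | succ n ih =>
    intro ε hε
    have h1 := ih (ε / 2) (by positivity)
    have h2 := (tendsto_log_mul_rpow_nhdsGT_zero (r := ε / 2) (by positivity)).abs
    have h3 := (h0 (ε / 2) (by positivity)).mul_const π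
    have h4 := h1.mul (h2.add h3)
    simp only [abs_zero, zero_mul, add_zero] at h4
    refine h4.congr' ?_
    filter_upwards [self_mem_nhdsWithin] with y hy
    have hy : 0 < y := hy
    have e : y ^ ε = y ^ (ε / 2) * y ^ (ε / 2) := by
      rw [← Real.rpow_add hy]; ring_nf
    rw [e, abs_mul, abs_of_pos (Real.rpow_pos_of_pos hy (ε / 2))]
    ring

lemma phi_tendsto (n : ℕ) :
    Tendsto (fun y : ℝ => y * (|Real.log y| + π) ^ n) (𝓝[≥] 0) (𝓝 0) := by
  have h := phi_aux n 1 one_pos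
  simp only [Real.rpow_one] at h
  have : 𝓝[≥] (0 : ℝ) = pure 0 ⊔ 𝓝[>] 0 := by
    rw [← Ioi_insert, nhdsWithin_insert]
  rw [this]
  refine Tendsto.sup ?_ h
  rw [tendsto_pure_left]
  intro s hs
  simpa using mem_of_mem_nhds hs

lemma key_cont {𝕜 : Type*} [RCLike 𝕜] (g ell : 𝕜 → 𝕜) (g' : 𝕜) (g0 : g 0 = 0)
    (hg : HasDerivAt g g' 0) (hg' : g' ≠ 0) (hl : ∀ z, ‖ell z‖ ≤ |Real.log ‖z‖| + π)
    (b n : ℕ) (hb : 1 ≤ b) : ContinuousAt (fun w => w ^ b * (ell (g w)) ^ n) 0 := by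
  have hT := (hg.isTheta_sub hg').2
  have hk : Tendsto (fun w : 𝕜 => (w, (0 : 𝕜))) (𝓝 0) (𝓝 0 ×ˢ pure 0) :=
    tendsto_id.prodMk (tendsto_pure.2 (Eventually.of_forall fun _ => rfl))
  have hO := hT.comp_tendsto hk
  simp only [Function.comp_def, g0, sub_zero] at hO
  obtain ⟨C, hC⟩ := hO.bound
  have hC' : ∀ᶠ w in 𝓝 (0 : 𝕜), ‖w‖ ≤ C * ‖g w‖ := hC
  have hu : Tendsto (fun w => ‖g w‖) (𝓝 0) (𝓝[≥] 0) := by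
    apply tendsto_nhdsWithin_of_tendsto_nhds_of_eventually_within
    · have := hg.continuousAt.norm.tendsto
      simpa [g0] using this
    · exact Eventually.of_forall fun w => norm_nonneg _
  have hphi := ((phi_tendsto n).comp hu).const_mul C
  simp only [mul_zero] at hphi
  have h0 : (0 : 𝕜) ^ b * (ell (g 0)) ^ n = 0 := by
    rw [zero_pow (by omega), zero_mul]
  unfold ContinuousAt
  dsimp only
  rw [h0]
  refine squeeze_zero_norm' ?_ hphi
  have h1 : ∀ᶠ w in 𝓝 (0 : 𝕜), ‖w‖ ≤ 1 := by
    have : Metric.closedBall (0 : 𝕜) 1 ∈ 𝓝 (0 : 𝕜) := Metric.closedBall_mem_nhds _ one_pos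
    filter_upwards [this] with w hw
    simpa using hw
  filter_upwards [hC', h1] with w hw hw1
  have hpos : 0 ≤ |Real.log ‖g w‖| + π := by positivity
  rw [norm_mul, norm_pow, norm_pow]
  calc ‖w‖ ^ b * ‖ell (g w)‖ ^ n ≤ ‖w‖ * (|Real.log ‖g w‖| + π) ^ n := by
        gcongr
        · exact pow_le_of_le_one (norm_nonneg _) hw1 (by omega)
        · exact hl _
    _ ≤ (C * ‖g w‖) * (|Real.log ‖g w‖| + π) ^ n := by gcongr
    _ = _ := by simp only [Function.comp]; ring

lemma norm_clog_le (z : ℂ) : ‖Complex.log z‖ ≤ |Real.log ‖z‖| + π := by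
  refine (Complex.norm_le_abs_re_add_abs_im _).trans ?_
  rw [Complex.log_re, Complex.log_im]
  gcongr
  exact Complex.abs_arg_le_pi z

lemma norm_rlog_le (z : ℝ) : ‖Real.log z‖ ≤ |Real.log ‖z‖| + π := by
  simp [Real.log_abs, pi_pos.le]

lemma hC_cont0 (b n : ℕ) (hb : 1 ≤ b) : ContinuousAt (fun w => w ^ b * hC w ^ n) 0 := by
  refine key_cont (fun w => 1 - Complex.exp (2 * Complex.I * w)) Complex.log
    (-(2 * Complex.I)) (by simp) ?_ (by simp) norm_clog_le b n hb
  have h1 : HasDerivAt (fun w : ℂ => 2 * Complex.I * w) (2 * Complex.I) 0 := by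
    simpa using (hasDerivAt_id (0 : ℂ)).const_mul (2 * Complex.I)
  simpa using h1.cexp.const_sub 1

lemma kk_cont0 (b n : ℕ) (hb : 1 ≤ b) : ContinuousAt (fun v => v ^ b * kk v ^ n) 0 := by
  refine key_cont (fun w => 1 - Real.exp (-2 * w)) Real.log
    2 (by simp) ?_ (by simp) norm_rlog_le b n hb
  have h1 : HasDerivAt (fun w : ℝ => -2 * w) (-2) 0 := by
    simpa using (hasDerivAt_id (0 : ℝ)).const_mul (-2)
  simpa using h1.exp.const_sub 1

lemma LL_cont0 (b n : ℕ) (hb : 1 ≤ b) : ContinuousAt (fun v => v ^ b * LL v ^ n) 0 := by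
  refine key_cont (fun w => 2 * Real.sin w) Real.log
    2 (by simp) ?_ (by simp) norm_rlog_le b n hb
  simpa using (Real.hasDerivAt_sin 0).const_mul 2

lemma q_lt {v : ℝ} (hv : 0 < v) : Real.exp (-2 * v) < 1 := by
  rw [Real.exp_lt_one_iff]; linarith

lemma kk_cont (b n : ℕ) (hb : 1 ≤ b) : ContinuousOn (fun v => v ^ b * kk v ^ n) (Ici 0) := by
  intro v hv
  rcases (mem_Ici.1 hv).eq_or_lt with rfl | hv
  · exact (kk_cont0 b n hb).continuousWithinAt
  · apply ContinuousAt.continuousWithinAt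
    have : 1 - Real.exp (-2 * v) ≠ 0 := by linarith [q_lt hv]
    unfold kk
    fun_prop (disch := assumption)

lemma hh_continuous : Continuous hh := by
  unfold hh
  refine Continuous.log (by fun_prop) fun v => by positivity

lemma LL_cont (b n : ℕ) (hb : 1 ≤ b) :
    ContinuousOn (fun v => v ^ b * LL v ^ n) (Icc 0 (π / 2)) := by
  intro v hv
  rcases hv.1.eq_or_lt with rfl | hv0
  · exact (LL_cont0 b n hb).continuousWithinAt
  · apply ContinuousAt.continuousWithinAt
    have : 2 * Real.sin v ≠ 0 := by
      have := Real.sin_pos_of_pos_of_lt_pi hv0 (by linarith [hv.2, pi_pos])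
      positivity
    unfold LL
    fun_prop (disch := assumption)

lemma LL_int (b n : ℕ) (hb : 1 ≤ b) :
    IntervalIntegrable (fun v => v ^ b * LL v ^ n) volume 0 (π / 2) := by
  apply ContinuousOn.intervalIntegrable
  rw [uIcc_of_le (by positivity)]
  exact LL_cont b n hb

lemma hh_O : hh =O[atTop] fun v => Real.exp (-2 * v) := by
  refine Asymptotics.IsBigO.of_bound 1 (Eventually.of_forall fun v => ?_)
  have h := Real.log_le_sub_one_of_pos (x := 1 + Real.exp (-2 * v)) (by positivity)
  have h0 : 0 ≤ hh v := Real.log_nonneg (by linarith [Real.exp_pos (-2 * v)])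
  rw [Real.norm_of_nonneg h0, Real.norm_of_nonneg (Real.exp_pos _).le]
  unfold hh
  linarith

lemma kk_O : kk =O[atTop] fun v => Real.exp (-2 * v) := by
  refine Asymptotics.IsBigO.of_bound 2 ?_
  filter_upwards [eventually_ge_atTop 1] with v hv
  have hq : Real.exp (-2 * v) ≤ 1 / 2 := by
    have h1 := Real.add_one_le_exp (2 * v)
    have h2 : Real.exp (-2 * v) * Real.exp (2 * v) = 1 := by
      rw [← Real.exp_add]; simp
    nlinarith [Real.exp_pos (-2 * v)]
  set q := Real.exp (-2 * v) with hqd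
  have hq0 : 0 < q := Real.exp_pos _
  have h := Real.one_sub_inv_le_log_of_pos (x := 1 - q) (by linarith)
  have h0 : kk v ≤ 0 := Real.log_nonpos (by linarith) (by linarith)
  rw [Real.norm_of_nonpos h0, Real.norm_of_nonneg hq0.le]
  have : (1 - q)⁻¹ ≤ 1 + 2 * q := by
    rw [inv_le_iff_one_le_mul₀ (by linarith)]
    nlinarith
  unfold kk
  linarith

lemma pow_O (f : ℝ → ℝ) (hf : f =O[atTop] fun v => Real.exp (-2 * v)) (b n : ℕ) (hn : 1 ≤ n) :
    (fun v => v ^ b * f v ^ n) =O[atTop] fun v => Real.exp (-1 * v) := by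
  have h1 : (fun v : ℝ => v ^ b) =O[atTop] Real.exp :=
    (isLittleO_pow_exp_atTop (n := b)).isBigO
  have h2 : (fun v => f v ^ n) =O[atTop] fun v => Real.exp (-2 * v) := by
    refine (hf.pow n).trans ?_
    refine Asymptotics.IsBigO.of_bound 1 ?_
    filter_upwards [eventually_gt_atTop 0] with v hv
    rw [norm_pow, Real.norm_of_nonneg (Real.exp_pos _).le, one_mul]
    exact pow_le_of_le_one (Real.exp_pos _).le (q_lt hv).le (by omega)
  refine (h1.mul h2).congr_right fun v => ?_
  rw [← Real.exp_add]; ring_nf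

lemma hh_int (b n : ℕ) (hn : 1 ≤ n) : IntegrableOn (fun v => v ^ b * hh v ^ n) (Ioi 0) := by
  refine integrable_of_isBigO_exp_neg one_pos ?_ (pow_O hh hh_O b n hn)
  have := hh_continuous
  fun_prop

lemma kk_int (b n : ℕ) (hb : 1 ≤ b) (hn : 1 ≤ n) :
    IntegrableOn (fun v => v ^ b * kk v ^ n) (Ioi 0) :=
  integrable_of_isBigO_exp_neg one_pos (kk_cont b n hb) (pow_O kk kk_O b n hn)


lemma slit {w : ℂ} (h0 : 0 ≤ w.re) (h1 : w.re ≤ π / 2) (h2 : 0 ≤ w.im) (hw : w ≠ 0) :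
    1 - Complex.exp (2 * Complex.I * w) ∈ Complex.slitPlane := by
  left
  have e : (Complex.exp (2 * Complex.I * w)).re = Real.exp (-2 * w.im) * Real.cos (2 * w.re) := by
    rw [Complex.exp_re]; simp
  rw [Complex.sub_re, e, Complex.one_re]
  rcases h2.eq_or_lt with h | h
  · have hre : 0 < w.re := by
      rcases h0.eq_or_lt with h' | h'
      · exact absurd (Complex.ext h'.symm h.symm) hw
      · exact h'
    have : Real.cos (2 * w.re) < Real.cos 0 :=
      Real.cos_lt_cos_of_nonneg_of_le_pi le_rfl (by linarith) (by linarith)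
    rw [← h]; simp at this ⊢; exact this
  · have hq := q_lt h
    nlinarith [Real.cos_le_one (2 * w.re), Real.exp_pos (-2 * w.im)]

lemma hC_diff {w : ℂ} (h0 : 0 ≤ w.re) (h1 : w.re ≤ π / 2) (h2 : 0 ≤ w.im) (hw : w ≠ 0)
    (b n : ℕ) : DifferentiableAt ℂ (fun w => w ^ b * hC w ^ n) w := by
  have := slit h0 h1 h2 hw
  unfold hC
  refine DifferentiableAt.mul (by fun_prop) (DifferentiableAt.pow ?_ n)
  exact DifferentiableAt.clog (by fun_prop) this

lemma hC_bot {x : ℝ} (h0 : 0 < x) (h1 : x ≤ π / 2) :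
    hC x = (LL x : ℂ) + ((x - π / 2 : ℝ) : ℂ) * Complex.I := by
  have hs : 0 < Real.sin x := Real.sin_pos_of_pos_of_lt_pi h0 (by linarith [pi_pos])
  have e : 1 - Complex.exp (2 * Complex.I * x)
      = Complex.exp ((LL x : ℂ) + ((x - π / 2 : ℝ) : ℂ) * Complex.I) := by
    rw [Complex.exp_add, Complex.exp_mul_I, ← Complex.ofReal_exp, ← Complex.ofReal_cos,
      ← Complex.ofReal_sin, Real.cos_sub_pi_div_two, Real.sin_sub_pi_div_two]
    unfold LL
    rw [Real.exp_log (by positivity), show 2 * Complex.I * (x : ℂ) = ((2 * x : ℝ) : ℂ) * Complex.I by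
      push_cast; ring, Complex.exp_mul_I, ← Complex.ofReal_cos, ← Complex.ofReal_sin,
      Real.cos_two_mul', Real.sin_two_mul]
    have := Real.sin_sq_add_cos_sq x
    apply Complex.ext <;> simp [-Complex.ofReal_sin, -Complex.ofReal_cos, -Complex.ofReal_pow, pow_two] <;> nlinarith
  unfold hC
  rw [e, Complex.log_exp]
  · simp; linarith [pi_pos]
  · simp; linarith [pi_pos]

lemma hC_right {y : ℝ} : hC (((π / 2 : ℝ) : ℂ) + y * Complex.I) = (hh y : ℂ) := by
  unfold hC hh
  rw [Complex.ofReal_log (by positivity)]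
  congr 1
  rw [show 2 * Complex.I * (((π / 2 : ℝ) : ℂ) + y * Complex.I) = π * Complex.I + ((-2 * y : ℝ) : ℂ) by
    push_cast; linear_combination (2 * (y : ℂ)) * Complex.I_mul_I, Complex.exp_add,
    Complex.exp_pi_mul_I]
  push_cast; ring

lemma hC_left {y : ℝ} (hy : 0 ≤ y) : hC (((0 : ℝ) : ℂ) + y * Complex.I) = (kk y : ℂ) := by
  unfold hC kk
  rw [Complex.ofReal_log]
  · congr 1
    rw [show 2 * Complex.I * (((0 : ℝ) : ℂ) + y * Complex.I) = ((-2 * y : ℝ) : ℂ) by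
      push_cast; linear_combination (2 * (y : ℂ)) * Complex.I_mul_I]
    push_cast; ring
  · have : Real.exp (-2 * y) ≤ 1 := by rw [Real.exp_le_one_iff]; linarith
    linarith

lemma right_int (b n : ℕ) (hn : 1 ≤ n) : IntegrableOn
    (fun v : ℝ => (((π / 2 : ℝ) : ℂ) + v * Complex.I) ^ b * (hh v : ℂ) ^ n) (Ioi 0) := by
  have h1 := ((hh_int 0 n hn).const_mul ((π / 2) ^ b)).add (hh_int b n hn)
  have h2 := h1.const_mul (2 ^ (b - 1))
  refine Integrable.mono' h2 ?_ ?_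
  · have := hh_continuous
    exact (by fun_prop : Continuous (fun v : ℝ =>
      (((π / 2 : ℝ) : ℂ) + v * Complex.I) ^ b * (hh v : ℂ) ^ n)).aestronglyMeasurable
  · refine (ae_restrict_iff' measurableSet_Ioi).2 (Eventually.of_forall fun v hv => ?_)
    have hv : 0 < v := hv
    have h0 : 0 ≤ hh v := Real.log_nonneg (by linarith [Real.exp_pos (-2 * v)])
    have hn1 : ‖((π / 2 : ℝ) : ℂ) + v * Complex.I‖ ≤ π / 2 + v := by
      refine (norm_add_le _ _).trans (le_of_eq ?_)
      rw [norm_mul, Complex.norm_real, Complex.norm_real, Complex.norm_I,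
        Real.norm_of_nonneg (by positivity), Real.norm_of_nonneg hv.le, mul_one]
    rw [norm_mul, norm_pow, norm_pow, Complex.norm_real, Real.norm_of_nonneg h0]
    calc _ ≤ (π / 2 + v) ^ b * hh v ^ n := by gcongr
      _ ≤ (2 ^ (b - 1) * ((π / 2) ^ b + v ^ b)) * hh v ^ n := by
        gcongr
        exact add_pow_le (by positivity) hv.le b
      _ = _ := by simp only [Pi.add_apply, pow_zero]; ring

lemma left_int (b n : ℕ) (hb : 1 ≤ b) (hn : 1 ≤ n) : IntegrableOn
    (fun v : ℝ => (((0 : ℝ) : ℂ) + v * Complex.I) ^ b * (kk v : ℂ) ^ n) (Ioi 0) := by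
  have h := ((kk_int b n hb hn).ofReal (𝕜 := ℂ)).const_mul (Complex.I ^ b)
  refine h.congr (Eventually.of_forall fun v => ?_)
  simp [mul_pow]; ring

lemma top_tendsto (b n : ℕ) (hn : 1 ≤ n) : Tendsto (fun V : ℝ => ∫ x : ℝ in (0 : ℝ)..(π / 2),
    (fun w : ℂ => w ^ b * hC w ^ n) (x + V * Complex.I)) atTop (𝓝 0) := by
  have hlim : Tendsto (fun V : ℝ => (2 ^ b * (3 / 2) * (V ^ b * Real.exp (-V))) * |π / 2 - 0|)
      atTop (𝓝 0) := by
    have := ((Real.tendsto_pow_mul_exp_neg_atTop_nhds_zero b).const_mul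
      (2 ^ b * (3 / 2))).mul_const |π / 2 - 0|
    simpa using this
  refine squeeze_zero_norm' ?_ hlim
  filter_upwards [eventually_ge_atTop 2] with V hV
  refine intervalIntegral.norm_integral_le_of_norm_le_const fun x hx => ?_
  rw [uIoc_of_le (by positivity)] at hx
  have hx0 := hx.1
  have hx1 := hx.2
  have hpi := pi_lt_four
  have hn1 : ‖(x : ℂ) + V * Complex.I‖ ≤ 2 * V := by
    refine (norm_add_le _ _).trans ?_
    rw [norm_mul, Complex.norm_real, Complex.norm_real, Complex.norm_I,
      Real.norm_of_nonneg hx0.le, Real.norm_of_nonneg (by linarith), mul_one]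
    linarith
  set q : ℂ := Complex.exp (2 * Complex.I * (x + V * Complex.I)) with hq
  have hqn : ‖q‖ = Real.exp (-2 * V) := by
    rw [hq, Complex.norm_exp]; simp
  have hE : Real.exp (-2 * V) ≤ 1 / 2 := by
    have h1 := Real.add_one_le_exp (2 * V)
    have h2 : Real.exp (-2 * V) * Real.exp (2 * V) = 1 := by
      rw [← Real.exp_add]; simp
    nlinarith [Real.exp_pos (-2 * V)]
  have hl : ‖hC (x + V * Complex.I)‖ ≤ 3 / 2 * Real.exp (-2 * V) := by
    have := Complex.norm_log_one_add_half_le_self (z := -q) (by rw [norm_neg, hqn]; exact hE)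
    rw [norm_neg, hqn, ← sub_eq_add_neg] at this
    exact this
  have hE2 : Real.exp (-2 * V) ≤ Real.exp (-V) := Real.exp_le_exp.2 (by linarith)
  rw [norm_mul, norm_pow, norm_pow]
  calc _ ≤ (2 * V) ^ b * (3 / 2 * Real.exp (-2 * V)) ^ n := by gcongr
    _ ≤ (2 * V) ^ b * (3 / 2 * Real.exp (-2 * V)) := by
      gcongr
      exact pow_le_of_le_one (by positivity) (by linarith) (by omega)
    _ ≤ (2 * V) ^ b * (3 / 2 * Real.exp (-V)) := by gcongr
    _ = _ := by rw [mul_pow]; ring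

theorem contour (b n : ℕ) (hb : 1 ≤ b) (hn : 1 ≤ n) :
    (∫ x : ℝ in (0 : ℝ)..(π / 2), (x : ℂ) ^ b * ((LL x : ℂ) + ((x - π / 2 : ℝ) : ℂ) * Complex.I) ^ n)
    + Complex.I * (∫ v in Ioi (0 : ℝ), (((π / 2 : ℝ) : ℂ) + v * Complex.I) ^ b * (hh v : ℂ) ^ n)
    - Complex.I * (∫ v in Ioi (0 : ℝ), (((0 : ℝ) : ℂ) + v * Complex.I) ^ b * (kk v : ℂ) ^ n) = 0 := by
  set f : ℂ → ℂ := fun w => w ^ b * hC w ^ n with hf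
  have hbot : (∫ x : ℝ in (0 : ℝ)..(π / 2), f (x + ((0 : ℝ) : ℂ) * Complex.I)) =
      ∫ x : ℝ in (0 : ℝ)..(π / 2), (x : ℂ) ^ b * ((LL x : ℂ) + ((x - π / 2 : ℝ) : ℂ) * Complex.I) ^ n := by
    refine intervalIntegral.integral_congr fun x hx => ?_
    rw [uIcc_of_le (by positivity)] at hx
    simp only [hf, Complex.ofReal_zero, zero_mul, add_zero]
    rcases hx.1.eq_or_lt with h | h
    · rw [← h]; simp [zero_pow (show b ≠ 0 by omega)]
    · rw [hC_bot h hx.2]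
  have hrect : ∀ V : ℝ, 0 < V →
      (∫ x : ℝ in (0 : ℝ)..(π / 2), f (x + ((0 : ℝ) : ℂ) * Complex.I))
      - (∫ x : ℝ in (0 : ℝ)..(π / 2), f (x + V * Complex.I))
      + Complex.I * (∫ v in (0 : ℝ)..V, (((π / 2 : ℝ) : ℂ) + v * Complex.I) ^ b * (hh v : ℂ) ^ n)
      - Complex.I * (∫ v in (0 : ℝ)..V, (((0 : ℝ) : ℂ) + v * Complex.I) ^ b * (kk v : ℂ) ^ n) = 0 := by
    intro V hV
    have h := Complex.integral_boundary_rect_eq_zero_of_continuousOn_of_differentiableOn f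
      0 ⟨π / 2, V⟩ ?_ ?_
    · simp only [Complex.zero_re, Complex.zero_im, smul_eq_mul] at h
      have e1 : (∫ v in (0 : ℝ)..V, (((π / 2 : ℝ) : ℂ) + v * Complex.I) ^ b * (hh v : ℂ) ^ n) =
          ∫ v in (0 : ℝ)..V, f (((π / 2 : ℝ) : ℂ) + v * Complex.I) := by
        refine intervalIntegral.integral_congr fun v hv => ?_
        simp only [hf]
        rw [hC_right]
      have e2 : (∫ v in (0 : ℝ)..V, (((0 : ℝ) : ℂ) + v * Complex.I) ^ b * (kk v : ℂ) ^ n) =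
          ∫ v in (0 : ℝ)..V, f (((0 : ℝ) : ℂ) + v * Complex.I) := by
        refine intervalIntegral.integral_congr fun v hv => ?_
        rw [uIcc_of_le hV.le] at hv
        simp only [hf]
        rw [hC_left hv.1]
      rw [e1, e2]
      exact h
    · simp only [Complex.zero_re, Complex.zero_im]
      rw [uIcc_of_le (by positivity), uIcc_of_le hV.le]
      intro w hw
      rw [Complex.mem_reProdIm] at hw
      by_cases h0 : w = 0
      · subst h0
        exact (hC_cont0 b n hb).continuousWithinAt
      · exact (hC_diff hw.1.1 hw.1.2 hw.2.1 h0 b n).continuousAt.continuousWithinAt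
    · simp only [Complex.zero_re, Complex.zero_im]
      rw [min_eq_left (by positivity), max_eq_right (by positivity), min_eq_left hV.le,
        max_eq_right hV.le]
      intro w hw
      rw [Complex.mem_reProdIm] at hw
      refine (hC_diff hw.1.1.le hw.1.2.le hw.2.1.le ?_ b n).differentiableWithinAt
      rintro rfl
      exact lt_irrefl _ hw.1.1
  have hl := ((tendsto_const_nhds (x := (∫ x : ℝ in (0 : ℝ)..(π / 2),
    f (x + ((0 : ℝ) : ℂ) * Complex.I))) (f := atTop)).sub (top_tendsto b n hn)).add
    ((intervalIntegral_tendsto_integral_Ioi 0 (right_int b n hn) tendsto_id).const_mul Complex.I)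
  have hl2 := hl.sub
    ((intervalIntegral_tendsto_integral_Ioi 0 (left_int b n hb hn) tendsto_id).const_mul Complex.I)
  rw [← hbot]
  have h3 : Tendsto (fun _ : ℝ => (0 : ℂ)) atTop (𝓝 0) := tendsto_const_nhds
  rw [sub_zero] at hl2
  refine tendsto_nhds_unique (hl2.congr' ?_) h3
  filter_upwards [eventually_gt_atTop 0] with V hV
  exact hrect V hV

lemma bot_int (b n : ℕ) (hb : 1 ≤ b) : IntervalIntegrable (fun x : ℝ =>
    (x : ℂ) ^ b * ((LL x : ℂ) + ((x - π / 2 : ℝ) : ℂ) * Complex.I) ^ n) volume 0 (π / 2) := by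
  apply ContinuousOn.intervalIntegrable
  rw [uIcc_of_le (by positivity)]
  have h : ContinuousOn (fun x : ℝ => (x : ℂ) ^ b * hC x ^ n) (Icc 0 (π / 2)) := by
    intro x hx
    rcases hx.1.eq_or_lt with h | h
    · rw [← h]
      have h1 := hC_cont0 b n hb
      refine ContinuousAt.continuousWithinAt ?_
      exact ContinuousAt.comp (f := fun x : ℝ => (x : ℂ)) (g := fun w => w ^ b * hC w ^ n)
        (by simpa using h1) Complex.continuous_ofReal.continuousAt
    · have h1 := (hC_diff (w := (x : ℂ)) (by simpa using hx.1) (by simpa using hx.2) (by simp)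
        (by exact_mod_cast h.ne') b n).continuousAt
      refine ContinuousAt.continuousWithinAt ?_
      exact ContinuousAt.comp (f := fun x : ℝ => (x : ℂ)) (g := fun w => w ^ b * hC w ^ n)
        h1 Complex.continuous_ofReal.continuousAt
  refine h.congr fun x hx => ?_
  dsimp only
  rcases hx.1.eq_or_lt with h | h
  · rw [← h]; simp [zero_pow (show b ≠ 0 by omega)]
  · rw [hC_bot h hx.2]

theorem contour_re (b n : ℕ) (hb : 1 ≤ b) (hn : 1 ≤ n) :
    (∫ x : ℝ in (0 : ℝ)..(π / 2),
      ((x : ℂ) ^ b * ((LL x : ℂ) + ((x - π / 2 : ℝ) : ℂ) * Complex.I) ^ n).re)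
    - (∫ v in Ioi (0 : ℝ), ((((π / 2 : ℝ) : ℂ) + v * Complex.I) ^ b * (hh v : ℂ) ^ n).im)
    + (∫ v in Ioi (0 : ℝ), ((((0 : ℝ) : ℂ) + v * Complex.I) ^ b * (kk v : ℂ) ^ n).im) = 0 := by
  have h := congrArg Complex.re (contour b n hb hn)
  have e1 := Complex.reCLM.intervalIntegral_comp_comm (bot_int b n hb)
  have e2 := Complex.imCLM.integral_comp_comm (right_int b n hn)
  have e3 := Complex.imCLM.integral_comp_comm (left_int b n hb hn)
  simp only [Complex.reCLM_apply, Complex.imCLM_apply] at e1 e2 e3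
  rw [e1, e2, e3]
  simp only [Complex.sub_re, Complex.add_re, Complex.I_mul_re, Complex.zero_re] at h
  linarith

theorem contour_im (b n : ℕ) (hb : 1 ≤ b) (hn : 1 ≤ n) :
    (∫ x : ℝ in (0 : ℝ)..(π / 2),
      ((x : ℂ) ^ b * ((LL x : ℂ) + ((x - π / 2 : ℝ) : ℂ) * Complex.I) ^ n).im)
    + (∫ v in Ioi (0 : ℝ), ((((π / 2 : ℝ) : ℂ) + v * Complex.I) ^ b * (hh v : ℂ) ^ n).re)
    - (∫ v in Ioi (0 : ℝ), ((((0 : ℝ) : ℂ) + v * Complex.I) ^ b * (kk v : ℂ) ^ n).re) = 0 := by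
  have h := congrArg Complex.im (contour b n hb hn)
  have e1 := Complex.imCLM.intervalIntegral_comp_comm (bot_int b n hb)
  have e2 := Complex.reCLM.integral_comp_comm (right_int b n hn)
  have e3 := Complex.reCLM.integral_comp_comm (left_int b n hb hn)
  simp only [Complex.reCLM_apply, Complex.imCLM_apply] at e1 e2 e3
  rw [e1, e2, e3]
  simp only [Complex.sub_im, Complex.add_im, Complex.I_mul_im, Complex.zero_im] at h
  linarith


/-- linear combinations of the moments, indexed by lists of (coefficient, b, n) -/
noncomputable def lin (F : ℕ → ℕ → ℝ) (l : List (ℝ × ℕ × ℕ)) : ℝ :=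
  (l.map fun t => t.1 * F t.2.1 t.2.2).sum

lemma lin_nil (F : ℕ → ℕ → ℝ) : lin F [] = 0 := rfl
lemma lin_cons (F : ℕ → ℕ → ℝ) (t : ℝ × ℕ × ℕ) (l : List (ℝ × ℕ × ℕ)) :
    lin F (t :: l) = t.1 * F t.2.1 t.2.2 + lin F l := by simp [lin]

lemma SS_lin (l : List (ℝ × ℕ × ℕ)) (hl : ∀ t ∈ l, 1 ≤ t.2.1) :
    IntervalIntegrable (fun x => lin (fun b n => x ^ b * LL x ^ n) l) volume 0 (π / 2) ∧
    ∫ x in (0 : ℝ)..(π / 2), lin (fun b n => x ^ b * LL x ^ n) l = lin SS l := by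
  induction l with
  | nil => simp [lin]
  | cons t l ih =>
    obtain ⟨h1, h2⟩ := ih fun t ht => hl t (List.mem_cons_of_mem _ ht)
    have h3 := (LL_int t.2.1 t.2.2 (hl t List.mem_cons_self)).const_mul t.1
    simp only [lin_cons]
    refine ⟨h3.add h1, ?_⟩
    rw [intervalIntegral.integral_add h3 h1, h2, intervalIntegral.integral_const_mul]
    rfl

lemma HH_lin (l : List (ℝ × ℕ × ℕ)) (hl : ∀ t ∈ l, 1 ≤ t.2.2) :
    IntegrableOn (fun x => lin (fun b n => x ^ b * hh x ^ n) l) (Ioi 0) ∧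
    ∫ x in Ioi (0 : ℝ), lin (fun b n => x ^ b * hh x ^ n) l = lin HH l := by
  induction l with
  | nil => simp [lin]
  | cons t l ih =>
    obtain ⟨h1, h2⟩ := ih fun t ht => hl t (List.mem_cons_of_mem _ ht)
    have h3 := (hh_int t.2.1 t.2.2 (hl t List.mem_cons_self)).const_mul t.1
    simp only [lin_cons]
    refine ⟨h3.add h1, ?_⟩
    rw [integral_add h3 h1, h2, integral_const_mul]
    rfl

lemma KK_lin (l : List (ℝ × ℕ × ℕ)) (hl : ∀ t ∈ l, 1 ≤ t.2.1 ∧ 1 ≤ t.2.2) :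
    IntegrableOn (fun x => lin (fun b n => x ^ b * kk x ^ n) l) (Ioi 0) ∧
    ∫ x in Ioi (0 : ℝ), lin (fun b n => x ^ b * kk x ^ n) l = lin KK l := by
  induction l with
  | nil => simp [lin]
  | cons t l ih =>
    obtain ⟨h1, h2⟩ := ih fun t ht => hl t (List.mem_cons_of_mem _ ht)
    have h3 := (kk_int t.2.1 t.2.2 (hl t List.mem_cons_self).1
      (hl t List.mem_cons_self).2).const_mul t.1
    simp only [lin_cons]
    refine ⟨h3.add h1, ?_⟩
    rw [integral_add h3 h1, h2, integral_const_mul]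
    rfl

lemma rel_re (b n : ℕ) (hb : 1 ≤ b) (hn : 1 ≤ n) (l1 l2 l3 : List (ℝ × ℕ × ℕ))
    (h1 : ∀ t ∈ l1, 1 ≤ t.2.1) (h2 : ∀ t ∈ l2, 1 ≤ t.2.2)
    (h3 : ∀ t ∈ l3, 1 ≤ t.2.1 ∧ 1 ≤ t.2.2)
    (e1 : ∀ x L : ℝ, ((x : ℂ) ^ b * ((L : ℂ) + ((x - π / 2 : ℝ) : ℂ) * Complex.I) ^ n).re =
      lin (fun b n => x ^ b * L ^ n) l1)
    (e2 : ∀ v h : ℝ, ((((π / 2 : ℝ) : ℂ) + v * Complex.I) ^ b * ((h ^ n : ℝ) : ℂ)).im =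
      lin (fun b n => v ^ b * h ^ n) l2)
    (e3 : ∀ v h : ℝ, ((((0 : ℝ) : ℂ) + v * Complex.I) ^ b * ((h ^ n : ℝ) : ℂ)).im =
      lin (fun b n => v ^ b * h ^ n) l3) :
    lin SS l1 - lin HH l2 + lin KK l3 = 0 := by
  have h := contour_re b n hb hn
  simp only [← Complex.ofReal_pow (hh _), ← Complex.ofReal_pow (kk _)] at h
  simp only [e1, e2, e3] at h
  rw [(SS_lin l1 h1).2, (HH_lin l2 h2).2, (KK_lin l3 h3).2] at h
  exact h

lemma rel_im (b n : ℕ) (hb : 1 ≤ b) (hn : 1 ≤ n) (l1 l2 l3 : List (ℝ × ℕ × ℕ))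
    (h1 : ∀ t ∈ l1, 1 ≤ t.2.1) (h2 : ∀ t ∈ l2, 1 ≤ t.2.2)
    (h3 : ∀ t ∈ l3, 1 ≤ t.2.1 ∧ 1 ≤ t.2.2)
    (e1 : ∀ x L : ℝ, ((x : ℂ) ^ b * ((L : ℂ) + ((x - π / 2 : ℝ) : ℂ) * Complex.I) ^ n).im =
      lin (fun b n => x ^ b * L ^ n) l1)
    (e2 : ∀ v h : ℝ, ((((π / 2 : ℝ) : ℂ) + v * Complex.I) ^ b * ((h ^ n : ℝ) : ℂ)).re =
      lin (fun b n => v ^ b * h ^ n) l2)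
    (e3 : ∀ v h : ℝ, ((((0 : ℝ) : ℂ) + v * Complex.I) ^ b * ((h ^ n : ℝ) : ℂ)).re =
      lin (fun b n => v ^ b * h ^ n) l3) :
    lin SS l1 + lin HH l2 - lin KK l3 = 0 := by
  have h := contour_im b n hb hn
  simp only [← Complex.ofReal_pow (hh _), ← Complex.ofReal_pow (kk _)] at h
  simp only [e1, e2, e3] at h
  rw [(SS_lin l1 h1).2, (HH_lin l2 h2).2, (KK_lin l3 h3).2] at h
  exact h

lemma SS_zero (b : ℕ) : SS b 0 = (π / 2) ^ (b + 1) / (b + 1) := by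
  unfold SS
  simp [integral_pow]

lemma r_re_11 : ((1) * SS 1 1)
    - ((1) * HH 1 1)
    + ((1) * KK 1 1) = 0 := by
  have h := rel_re 1 1 (by norm_num) (by norm_num)
    [(1, 1, 1)]
    [(1, 1, 1)] [(1, 1, 1)]
    (by simp) (by simp) (by simp)
    (by intro x L; simp [pow_succ, lin]; try ring)
    (by intro x L; simp [pow_succ, lin, -Complex.ofReal_mul, -Complex.ofReal_pow]; try ring)
    (by intro x L; simp [pow_succ, lin, -Complex.ofReal_mul, -Complex.ofReal_pow]; try ring)
  simp only [lin_cons, lin_nil] at h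
  linarith

lemma r_re_21 : ((1) * SS 2 1)
    - ((π) * HH 1 1)
    + (0) = 0 := by
  have h := rel_re 2 1 (by norm_num) (by norm_num)
    [(1, 2, 1)]
    [(π, 1, 1)] []
    (by simp) (by simp) (by simp)
    (by intro x L; simp [pow_succ, lin]; try ring)
    (by intro x L; simp [pow_succ, lin, -Complex.ofReal_mul, -Complex.ofReal_pow]; try ring)
    (by intro x L; simp [pow_succ, lin, -Complex.ofReal_mul, -Complex.ofReal_pow]; try ring)
  simp only [lin_cons, lin_nil] at h
  linarith

lemma r_re_31 : ((1) * SS 3 1)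
    - ((3*π^2/4) * HH 1 1 + (-1) * HH 3 1)
    + ((-1) * KK 3 1) = 0 := by
  have h := rel_re 3 1 (by norm_num) (by norm_num)
    [(1, 3, 1)]
    [(3*π^2/4, 1, 1), (-1, 3, 1)] [(-1, 3, 1)]
    (by simp) (by simp) (by simp)
    (by intro x L; simp [pow_succ, lin]; try ring)
    (by intro x L; simp [pow_succ, lin, -Complex.ofReal_mul, -Complex.ofReal_pow]; try ring)
    (by intro x L; simp [pow_succ, lin, -Complex.ofReal_mul, -Complex.ofReal_pow]; try ring)
  simp only [lin_cons, lin_nil] at h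
  linarith

lemma r_re_41 : ((1) * SS 4 1)
    - ((π^3/2) * HH 1 1 + (-2*π) * HH 3 1)
    + (0) = 0 := by
  have h := rel_re 4 1 (by norm_num) (by norm_num)
    [(1, 4, 1)]
    [(π^3/2, 1, 1), (-2*π, 3, 1)] []
    (by simp) (by simp) (by simp)
    (by intro x L; simp [pow_succ, lin]; try ring)
    (by intro x L; simp [pow_succ, lin, -Complex.ofReal_mul, -Complex.ofReal_pow]; try ring)
    (by intro x L; simp [pow_succ, lin, -Complex.ofReal_mul, -Complex.ofReal_pow]; try ring)
  simp only [lin_cons, lin_nil] at h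
  linarith

lemma r_im_11 : ((1) * SS 2 0 + (-π/2) * SS 1 0)
    + ((π/2) * HH 0 1)
    - (0) = 0 := by
  have h := rel_im 1 1 (by norm_num) (by norm_num)
    [(1, 2, 0), (-π/2, 1, 0)]
    [(π/2, 0, 1)] []
    (by simp) (by simp) (by simp)
    (by intro x L; simp [pow_succ, lin]; try ring)
    (by intro x L; simp [pow_succ, lin, -Complex.ofReal_mul, -Complex.ofReal_pow]; try ring)
    (by intro x L; simp [pow_succ, lin, -Complex.ofReal_mul, -Complex.ofReal_pow]; try ring)
  simp only [lin_cons, lin_nil] at h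
  linarith

lemma r_im_12 : ((2) * SS 2 1 + (-π) * SS 1 1)
    + ((π/2) * HH 0 2)
    - (0) = 0 := by
  have h := rel_im 1 2 (by norm_num) (by norm_num)
    [(2, 2, 1), (-π, 1, 1)]
    [(π/2, 0, 2)] []
    (by simp) (by simp) (by simp)
    (by intro x L; simp [pow_succ, lin]; try ring)
    (by intro x L; simp [pow_succ, lin, -Complex.ofReal_mul, -Complex.ofReal_pow]; try ring)
    (by intro x L; simp [pow_succ, lin, -Complex.ofReal_mul, -Complex.ofReal_pow]; try ring)
  simp only [lin_cons, lin_nil] at h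
  linarith

lemma r_im_22 : ((2) * SS 3 1 + (-π) * SS 2 1)
    + ((π^2/4) * HH 0 2 + (-1) * HH 2 2)
    - ((-1) * KK 2 2) = 0 := by
  have h := rel_im 2 2 (by norm_num) (by norm_num)
    [(2, 3, 1), (-π, 2, 1)]
    [(π^2/4, 0, 2), (-1, 2, 2)] [(-1, 2, 2)]
    (by simp) (by simp) (by simp)
    (by intro x L; simp [pow_succ, lin]; try ring)
    (by intro x L; simp [pow_succ, lin, -Complex.ofReal_mul, -Complex.ofReal_pow]; try ring)
    (by intro x L; simp [pow_succ, lin, -Complex.ofReal_mul, -Complex.ofReal_pow]; try ring)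
  simp only [lin_cons, lin_nil] at h
  linarith

lemma r_im_32 : ((2) * SS 4 1 + (-π) * SS 3 1)
    + ((π^3/8) * HH 0 2 + (-3*π/2) * HH 2 2)
    - (0) = 0 := by
  have h := rel_im 3 2 (by norm_num) (by norm_num)
    [(2, 4, 1), (-π, 3, 1)]
    [(π^3/8, 0, 2), (-3*π/2, 2, 2)] []
    (by simp) (by simp) (by simp)
    (by intro x L; simp [pow_succ, lin]; try ring)
    (by intro x L; simp [pow_succ, lin, -Complex.ofReal_mul, -Complex.ofReal_pow]; try ring)
    (by intro x L; simp [pow_succ, lin, -Complex.ofReal_mul, -Complex.ofReal_pow]; try ring)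
  simp only [lin_cons, lin_nil] at h
  linarith

lemma r_re_12 : ((1) * SS 1 2 + (-1) * SS 3 0 + (π) * SS 2 0 + (-π^2/4) * SS 1 0)
    - ((1) * HH 1 2)
    + ((1) * KK 1 2) = 0 := by
  have h := rel_re 1 2 (by norm_num) (by norm_num)
    [(1, 1, 2), (-1, 3, 0), (π, 2, 0), (-π^2/4, 1, 0)]
    [(1, 1, 2)] [(1, 1, 2)]
    (by simp) (by simp) (by simp)
    (by intro x L; simp [pow_succ, lin]; try ring)
    (by intro x L; simp [pow_succ, lin, -Complex.ofReal_mul, -Complex.ofReal_pow]; try ring)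
    (by intro x L; simp [pow_succ, lin, -Complex.ofReal_mul, -Complex.ofReal_pow]; try ring)
  simp only [lin_cons, lin_nil] at h
  linarith

lemma r_re_22 : ((1) * SS 2 2 + (-1) * SS 4 0 + (π) * SS 3 0 + (-π^2/4) * SS 2 0)
    - ((π) * HH 1 2)
    + (0) = 0 := by
  have h := rel_re 2 2 (by norm_num) (by norm_num)
    [(1, 2, 2), (-1, 4, 0), (π, 3, 0), (-π^2/4, 2, 0)]
    [(π, 1, 2)] []
    (by simp) (by simp) (by simp)
    (by intro x L; simp [pow_succ, lin]; try ring)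
    (by intro x L; simp [pow_succ, lin, -Complex.ofReal_mul, -Complex.ofReal_pow]; try ring)
    (by intro x L; simp [pow_succ, lin, -Complex.ofReal_mul, -Complex.ofReal_pow]; try ring)
  simp only [lin_cons, lin_nil] at h
  linarith

lemma r_im_13 : ((3) * SS 2 2 + (-3*π/2) * SS 1 2 + (-1) * SS 4 0 + (3*π/2) * SS 3 0 + (-3*π^2/4) * SS 2 0 + (π^3/8) * SS 1 0)
    + ((π/2) * HH 0 3)
    - (0) = 0 := by
  have h := rel_im 1 3 (by norm_num) (by norm_num)
    [(3, 2, 2), (-3*π/2, 1, 2), (-1, 4, 0), (3*π/2, 3, 0), (-3*π^2/4, 2, 0), (π^3/8, 1, 0)]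
    [(π/2, 0, 3)] []
    (by simp) (by simp) (by simp)
    (by intro x L; simp [pow_succ, lin]; try ring)
    (by intro x L; simp [pow_succ, lin, -Complex.ofReal_mul, -Complex.ofReal_pow]; try ring)
    (by intro x L; simp [pow_succ, lin, -Complex.ofReal_mul, -Complex.ofReal_pow]; try ring)
  simp only [lin_cons, lin_nil] at h
  linarith

lemma r_re_13 : ((1) * SS 1 3 + (-3) * SS 3 1 + (3*π) * SS 2 1 + (-3*π^2/4) * SS 1 1)
    - ((1) * HH 1 3)
    + ((1) * KK 1 3) = 0 := by
  have h := rel_re 1 3 (by norm_num) (by norm_num)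
    [(1, 1, 3), (-3, 3, 1), (3*π, 2, 1), (-3*π^2/4, 1, 1)]
    [(1, 1, 3)] [(1, 1, 3)]
    (by simp) (by simp) (by simp)
    (by intro x L; simp [pow_succ, lin]; try ring)
    (by intro x L; simp [pow_succ, lin, -Complex.ofReal_mul, -Complex.ofReal_pow]; try ring)
    (by intro x L; simp [pow_succ, lin, -Complex.ofReal_mul, -Complex.ofReal_pow]; try ring)
  simp only [lin_cons, lin_nil] at h
  linarith


lemma hh_pos (v : ℝ) : 0 < hh v := Real.log_pos (by linarith [Real.exp_pos (-2 * v)])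

lemma exp_hh (v : ℝ) : Real.exp (hh v) = 1 + Real.exp (-2 * v) := by
  unfold hh; rw [Real.exp_log (by positivity)]

lemma hh_deriv (v : ℝ) :
    HasDerivAt hh (-2 * Real.exp (-2 * v) / (1 + Real.exp (-2 * v))) v := by
  have h1 : HasDerivAt (fun w : ℝ => -2 * w) (-2) v := by
    simpa using (hasDerivAt_id v).const_mul (-2)
  have h2 := (h1.exp.const_add 1).log (by positivity)
  have h3 : HasDerivAt hh _ v := h2
  refine h3.congr_deriv ?_
  ring

lemma q_mul (u : ℝ) : Real.exp (-2 * u) * Real.exp (2 * u) = 1 := by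
  rw [← Real.exp_add]; simp

lemma two_hh (u : ℝ) : 2 * u + hh u = Real.log (Real.exp (2 * u) + 1) := by
  have : Real.exp (2 * u) + 1 = Real.exp (2 * u) * (1 + Real.exp (-2 * u)) := by
    linear_combination -q_mul u
  rw [this, Real.log_mul (by positivity) (by positivity), Real.log_exp]; rfl

lemma kk_phi1 (u : ℝ) : kk (u + hh u / 2) = - hh u := by
  unfold kk
  rw [show -2 * (u + hh u / 2) = -2 * u + -hh u by ring, Real.exp_add, Real.exp_neg (hh u), exp_hh]
  unfold hh
  rw [← Real.log_inv]
  congr 1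
  field_simp
  ring

lemma kk_phi2 (u : ℝ) : kk (hh u / 2) = -2 * u - hh u := by
  unfold kk
  rw [show -2 * (hh u / 2) = -hh u by ring, Real.exp_neg (hh u), exp_hh]
  unfold hh
  have : 1 - (1 + Real.exp (-2 * u))⁻¹ = Real.exp (-2 * u) / (1 + Real.exp (-2 * u)) := by
    field_simp; ring
  rw [this, Real.log_div (by positivity) (by positivity), Real.log_exp]

lemma image1 : (fun u => u + hh u / 2) '' Ioi 0 = Ioi (Real.log 2 / 2) := by
  ext v
  constructor
  · rintro ⟨u, hu, rfl⟩
    have hu : 0 < u := hu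
    have h := two_hh u
    have h1 : Real.log 2 < Real.log (Real.exp (2 * u) + 1) := by
      apply Real.log_lt_log (by norm_num)
      have := Real.one_lt_exp_iff.2 (show 0 < 2 * u by linarith)
      linarith
    simp only [mem_Ioi]
    linarith
  · intro hv
    have hv : Real.log 2 / 2 < v := hv
    have h2 : 2 < Real.exp (2 * v) := by
      rw [← Real.log_lt_iff_lt_exp (by norm_num)]; linarith
    refine ⟨Real.log (Real.exp (2 * v) - 1) / 2, ?_, ?_⟩
    · have := Real.log_pos (show 1 < Real.exp (2 * v) - 1 by linarith)
      simp only [mem_Ioi]; linarith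
    · have h := two_hh (Real.log (Real.exp (2 * v) - 1) / 2)
      rw [show 2 * (Real.log (Real.exp (2 * v) - 1) / 2) = Real.log (Real.exp (2 * v) - 1) by ring,
        Real.exp_log (by linarith), sub_add_cancel, Real.log_exp] at h
      dsimp only
      linarith

lemma image2 : (fun u => hh u / 2) '' Ioi 0 = Ioo 0 (Real.log 2 / 2) := by
  ext v
  constructor
  · rintro ⟨u, hu, rfl⟩
    have hu : 0 < u := hu
    have h1 : hh u < Real.log 2 := by
      apply Real.log_lt_log (by positivity)
      linarith [q_lt hu]
    exact ⟨by have := hh_pos u; positivity, by dsimp only; linarith⟩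
  · rintro ⟨hv0, hv⟩
    have h2 : Real.exp (2 * v) < 2 := by
      rw [← Real.lt_log_iff_exp_lt (by norm_num)]; linarith
    have h1 : 1 < Real.exp (2 * v) := Real.one_lt_exp_iff.2 (by linarith)
    refine ⟨-Real.log (Real.exp (2 * v) - 1) / 2, ?_, ?_⟩
    · have := Real.log_neg (show 0 < Real.exp (2 * v) - 1 by linarith) (by linarith)
      simp only [mem_Ioi]; linarith
    · unfold hh
      dsimp only
      rw [show -2 * (-Real.log (Real.exp (2 * v) - 1) / 2) = Real.log (Real.exp (2 * v) - 1) by ring,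
        Real.exp_log (by linarith), add_sub_cancel, Real.log_exp]
      ring

lemma hh_inj : Function.Injective hh := by
  intro a b h
  have := congrArg Real.exp h
  rw [exp_hh, exp_hh] at this
  have := Real.exp_injective (add_left_cancel this)
  linarith

lemma phi1_inj : Function.Injective (fun u => u + hh u / 2) := by
  intro a b h
  dsimp only at h
  have h1 : Real.log (Real.exp (2 * a) + 1) = Real.log (Real.exp (2 * b) + 1) := by
    rw [← two_hh, ← two_hh]; linarith
  have h2 := congrArg Real.exp h1
  rw [Real.exp_log (by positivity), Real.exp_log (by positivity)] at h2
  have := Real.exp_injective (add_right_cancel h2)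
  linarith

lemma T_rel (F : ℝ → ℝ → ℝ) (hs : ∀ a b, F a b = F b a)
    (hF : IntegrableOn (fun v => F (-2 * v) (kk v)) (Ioi 0)) :
    ∫ v in Ioi (0 : ℝ), F (-2 * v) (kk v) = ∫ u in Ioi (0 : ℝ), F (-2 * u - hh u) (-hh u) := by
  have hl : 0 < Real.log 2 := Real.log_pos (by norm_num)
  have hsplit : Ioi (0 : ℝ) = Ioc 0 (Real.log 2 / 2) ∪ Ioi (Real.log 2 / 2) :=
    (Ioc_union_Ioi_eq_Ioi (by positivity)).symm
  have hI1 : IntegrableOn (fun v => F (-2 * v) (kk v)) (Ioc 0 (Real.log 2 / 2)) :=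
    hF.mono_set Ioc_subset_Ioi_self
  have hI2 : IntegrableOn (fun v => F (-2 * v) (kk v)) (Ioi (Real.log 2 / 2)) :=
    hF.mono_set (Ioi_subset_Ioi (by positivity))
  have hd1 : ∀ u ∈ Ioi (0 : ℝ), HasDerivWithinAt (fun u => u + hh u / 2)
      (1 / (1 + Real.exp (-2 * u))) (Ioi 0) u := by
    intro u _
    have h3 : HasDerivAt (fun u => u + hh u / 2) _ u :=
      (hasDerivAt_id u).add ((hh_deriv u).div_const 2)
    refine (h3.congr_deriv ?_).hasDerivWithinAt
    field_simp; ring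
  have hd2 : ∀ u ∈ Ioi (0 : ℝ), HasDerivWithinAt (fun u => hh u / 2)
      (-(Real.exp (-2 * u) / (1 + Real.exp (-2 * u)))) (Ioi 0) u := by
    intro u _
    refine (((hh_deriv u).div_const 2).congr_deriv ?_).hasDerivWithinAt
    ring
  have hi2 : InjOn (fun u => hh u / 2) (Ioi 0) := by
    intro a _ b _ h
    apply hh_inj
    dsimp only at h
    linarith
  have hi1 : InjOn (fun u => u + hh u / 2) (Ioi 0) := phi1_inj.injOn
  have a1 : ∀ u : ℝ, |1 / (1 + Real.exp (-2 * u))| = 1 / (1 + Real.exp (-2 * u)) := fun u =>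
    abs_of_pos (by positivity)
  have a2 : ∀ u : ℝ, |-(Real.exp (-2 * u) / (1 + Real.exp (-2 * u)))| =
      Real.exp (-2 * u) / (1 + Real.exp (-2 * u)) := fun u => by
    rw [abs_neg]; exact abs_of_pos (by positivity)
  have s1 := integral_image_eq_integral_abs_deriv_smul measurableSet_Ioi hd1 hi1
    (fun v => F (-2 * v) (kk v))
  have s2 := integral_image_eq_integral_abs_deriv_smul measurableSet_Ioi hd2 hi2
    (fun v => F (-2 * v) (kk v))
  have j1 := (integrableOn_image_iff_integrableOn_abs_deriv_smul measurableSet_Ioi hd1 hi1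
    (fun v => F (-2 * v) (kk v))).1 (by rw [image1]; exact hI2)
  have j2 := (integrableOn_image_iff_integrableOn_abs_deriv_smul measurableSet_Ioi hd2 hi2
    (fun v => F (-2 * v) (kk v))).1 (by rw [image2]; exact hI1.mono_set Ioo_subset_Ioc_self)
  rw [hsplit, setIntegral_union (Ioc_disjoint_Ioi le_rfl) measurableSet_Ioi hI1 hI2, ← hsplit,
    integral_Ioc_eq_integral_Ioo, ← image1, ← image2, s1, s2, ← integral_add j2 j1]
  refine setIntegral_congr_fun measurableSet_Ioi fun u _ => ?_
  simp only [a1, a2, kk_phi1, kk_phi2, smul_eq_mul]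
  rw [show -2 * (hh u / 2) = -hh u by ring, show -2 * (u + hh u / 2) = -2 * u - hh u by ring,
    hs (-hh u)]
  field_simp
  ring

lemma T_lin (F : ℝ → ℝ → ℝ) (hs : ∀ a b, F a b = F b a) (l1 l2 : List (ℝ × ℕ × ℕ))
    (h1 : ∀ t ∈ l1, 1 ≤ t.2.1 ∧ 1 ≤ t.2.2) (h2 : ∀ t ∈ l2, 1 ≤ t.2.2)
    (e1 : ∀ v k, F (-2 * v) k = lin (fun b n => v ^ b * k ^ n) l1)
    (e2 : ∀ v h, F (-2 * v - h) (-h) = lin (fun b n => v ^ b * h ^ n) l2) :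
    lin KK l1 = lin HH l2 := by
  have hT := T_rel F hs (by simp only [e1]; exact (KK_lin l1 h1).1)
  simp only [e1, e2] at hT
  rwa [(KK_lin l1 h1).2, (HH_lin l2 h2).2] at hT

lemma t4 : 4 * KK 2 1 - 2 * KK 1 2 = -4 * HH 2 1 - 6 * HH 1 2 - 2 * HH 0 3 := by
  have h := T_lin (fun a b => a * b * (a + b)) (by intros; ring)
    [(4, 2, 1), (-2, 1, 2)] [(-4, 2, 1), (-6, 1, 2), (-2, 0, 3)] (by simp) (by simp)
    (by intros; simp [lin]; ring) (by intros; simp [lin]; ring)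
  simp only [lin_cons, lin_nil] at h
  linarith

lemma t5 : 4 * KK 2 2 = 4 * HH 2 2 + 4 * HH 1 3 + HH 0 4 := by
  have h := T_lin (fun a b => a ^ 2 * b ^ 2) (by intros; ring)
    [(4, 2, 2)] [(4, 2, 2), (4, 1, 3), (1, 0, 4)] (by simp) (by simp)
    (by intros; simp [lin]; ring) (by intros; simp [lin]; ring)
  simp only [lin_cons, lin_nil] at h
  linarith

lemma t6 : -2 * KK 1 3 - 8 * KK 3 1 = 8 * HH 1 3 + 2 * HH 0 4 + 12 * HH 2 2 + 8 * HH 3 1 := by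
  have h := T_lin (fun a b => a * b ^ 3 + a ^ 3 * b) (by intros; ring)
    [(-2, 1, 3), (-8, 3, 1)] [(8, 1, 3), (2, 0, 4), (12, 2, 2), (8, 3, 1)] (by simp) (by simp)
    (by intros; simp [lin]; ring) (by intros; simp [lin]; ring)
  simp only [lin_cons, lin_nil] at h
  linarith

lemma int_pow_exp (b : ℕ) (r : ℝ) (hr : 0 < r) :
    ∫ t in Ioi (0 : ℝ), t ^ b * Real.exp (-(r * t)) = b.factorial / r ^ (b + 1) := by
  have h := Real.integral_rpow_mul_exp_neg_mul_Ioi (a := b + 1) (by positivity) hr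
  rw [Real.Gamma_nat_eq_factorial] at h
  simp only [add_sub_cancel_right, Real.rpow_natCast] at h
  rw [h, show (b + 1 : ℝ) = ((b + 1 : ℕ) : ℝ) by push_cast; ring, Real.rpow_natCast, one_div, inv_pow]
  ring

lemma integrable_pow_exp (b : ℕ) (r : ℝ) (hr : 0 < r) :
    IntegrableOn (fun t : ℝ => t ^ b * Real.exp (-(r * t))) (Ioi 0) := by
  by_contra hc
  have h := int_pow_exp b r hr
  rw [integral_undef hc] at h
  have : 0 < (b.factorial : ℝ) / r ^ (b + 1) := by positivity
  linarith

lemma KK_one (b : ℕ) (hb : 1 ≤ b) :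
    KK b 1 = -(b.factorial / 2 ^ (b + 1)) * zetaVal (b + 2) := by
  set F : ℕ → ℝ → ℝ := fun n v => (1 / (n + 1 : ℝ)) * (v ^ b * Real.exp (-((2 * (n + 1)) * v))) with hFd
  have hint : ∀ n, ∫ v in Ioi (0 : ℝ), F n v = b.factorial / 2 ^ (b + 1) * (1 / (n + 1 : ℝ) ^ (b + 2)) := by
    intro n
    simp only [hFd]
    rw [integral_const_mul, int_pow_exp b _ (by positivity), mul_pow]
    field_simp
    ring
  have hI : ∀ n, Integrable (F n) (volume.restrict (Ioi 0)) := fun n =>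
    (integrable_pow_exp b (2 * (n + 1)) (by positivity)).const_mul _
  have hnorm : ∀ n, ∫ v in Ioi (0 : ℝ), ‖F n v‖ = b.factorial / 2 ^ (b + 1) * (1 / (n + 1 : ℝ) ^ (b + 2)) := by
    intro n
    rw [← hint n]
    refine setIntegral_congr_fun measurableSet_Ioi fun v hv => ?_
    have hv : 0 < v := hv
    exact Real.norm_of_nonneg (by simp only [hFd]; positivity)
  have hsum : Summable fun n : ℕ => (1 / (n + 1 : ℝ) ^ (b + 2)) := by
    have := (summable_nat_add_iff 1).2 (Real.summable_one_div_nat_pow (p := b + 2) |>.2 (by omega))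
    simpa using this
  have h := hasSum_integral_of_summable_integral_norm hI (by
    simp only [hnorm]; exact hsum.mul_left _)
  simp only [hint] at h
  have h2 := (hsum.hasSum.mul_left ((b.factorial : ℝ) / 2 ^ (b + 1))).unique h
  have h3 : ∫ v in Ioi (0 : ℝ), ∑' n, F n v = - KK b 1 := by
    unfold KK
    rw [← integral_neg]
    refine setIntegral_congr_fun measurableSet_Ioi fun v hv => ?_
    have hv : 0 < v := hv
    have hl := (Real.hasSum_pow_div_log_of_abs_lt_one (x := Real.exp (-2 * v))
      (by rw [abs_of_pos (Real.exp_pos _)]; exact q_lt hv)).mul_left (v ^ b)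
    rw [show -(v ^ b * kk v ^ 1) = v ^ b * -Real.log (1 - Real.exp (-2 * v)) by unfold kk; ring,
      ← hl.tsum_eq]
    refine tsum_congr fun n => ?_
    simp only [hFd]
    rw [← Real.exp_nat_mul]
    push_cast
    rw [show -((2 * ((n : ℝ) + 1)) * v) = (n + 1) * (-2 * v) by ring]
    ring
  rw [h3] at h2
  unfold zetaVal
  linarith

lemma HH_one (b : ℕ) (hb : 1 ≤ b) : HH b 1 = (1 / 2 ^ (b + 1) - 1) * KK b 1 := by
  have h1 : HH b 1 + KK b 1 = ∫ v in Ioi (0 : ℝ), (1 / 2 ^ b) * ((2 * v) ^ b * kk (2 * v) ^ 1) := by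
    unfold HH KK
    rw [← integral_add (hh_int b 1 le_rfl) (kk_int b 1 hb le_rfl)]
    refine setIntegral_congr_fun measurableSet_Ioi fun v hv => ?_
    have hv : 0 < v := hv
    have hq := q_lt hv
    have : kk (2 * v) = hh v + kk v := by
      unfold kk hh
      rw [← Real.log_mul (by positivity) (by linarith)]
      congr 1
      rw [show -2 * (2 * v) = -2 * v + -2 * v by ring, Real.exp_add]
      ring
    rw [this, mul_pow]
    field_simp
    try ring
  rw [integral_const_mul, integral_comp_mul_left_Ioi (fun v => v ^ b * kk v ^ 1) 0 two_pos,
    mul_zero, smul_eq_mul] at h1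
  have h2 : (∫ v in Ioi (0 : ℝ), v ^ b * kk v ^ 1) = KK b 1 := rfl
  rw [h2] at h1
  have : (1 : ℝ) / 2 ^ (b + 1) = 1 / 2 ^ b * 2⁻¹ := by rw [pow_succ]; field_simp
  rw [this]
  linarith


lemma polyLog_one_arg (m : ℕ) : polyLog m 1 = zetaVal m := by
  unfold polyLog zetaVal; simp

lemma sum_zeta (m : ℕ) (hm : 2 ≤ m) : Summable fun n : ℕ => (1 / (n + 1 : ℝ) ^ m) := by
  have := (summable_nat_add_iff 1).2 (Real.summable_one_div_nat_pow (p := m) |>.2 (by omega))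
  simpa using this

lemma polyLog_cont (m : ℕ) (hm : 2 ≤ m) : ContinuousOn (polyLog m) (Icc 0 1) := by
  unfold polyLog
  refine continuousOn_tsum (fun k => by fun_prop) (sum_zeta m hm) ?_
  intro k y hy
  rw [norm_div, norm_pow, norm_pow, Real.norm_of_nonneg hy.1, Real.norm_of_nonneg (by positivity)]
  gcongr
  exact pow_le_one₀ hy.1 hy.2

lemma polyLog_deriv (m : ℕ) (y : ℝ) (h0 : 0 < y) (h1 : y < 1) :
    HasDerivAt (polyLog (m + 1)) (polyLog m y / y) y := by
  obtain ⟨r, hyr, hr1⟩ := exists_between h1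
  have hr0 : 0 < r := h0.trans hyr
  have h := hasDerivAt_tsum_of_isPreconnected (𝕜 := ℝ)
    (g := fun (k : ℕ) (z : ℝ) => z ^ (k + 1) / (k + 1 : ℝ) ^ (m + 1))
    (g' := fun (k : ℕ) (z : ℝ) => z ^ k / (k + 1 : ℝ) ^ m) (u := fun k => r ^ k)
    (t := Ioo (-r) r) (y₀ := 0) (y := y)
    (summable_geometric_of_lt_one hr0.le hr1) isOpen_Ioo isPreconnected_Ioo ?_ ?_ ?_ ?_ ?_
  · have h' : HasDerivAt (polyLog (m + 1)) _ y := h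
    refine h'.congr_deriv ?_
    unfold polyLog
    rw [← tsum_div_const]
    refine tsum_congr fun k => ?_
    rw [pow_succ]
    field_simp
  · intro k z _
    have := (hasDerivAt_pow (k + 1) z).div_const ((k + 1 : ℝ) ^ (m + 1))
    refine this.congr_deriv ?_
    rw [Nat.add_sub_cancel]
    push_cast
    field_simp
    ring
  · intro k z hz
    have hz' : |z| ≤ r := abs_le.2 ⟨hz.1.le, hz.2.le⟩
    rw [norm_div, norm_pow, norm_pow, Real.norm_eq_abs z,
      Real.norm_of_nonneg (show (0 : ℝ) ≤ k + 1 by positivity)]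
    have hk : (1 : ℝ) ≤ (k + 1 : ℝ) ^ m := one_le_pow₀ (by linarith [(Nat.cast_nonneg k : (0 : ℝ) ≤ k)])
    calc |z| ^ k / (k + 1 : ℝ) ^ m ≤ |z| ^ k := div_le_self (by positivity) hk
      _ ≤ r ^ k := by gcongr
  · exact ⟨by linarith, hr0⟩
  · simpa using summable_zero
  · exact ⟨by linarith, hyr⟩

lemma y_lt (v : ℝ) : Real.exp (-hh v) < 1 := by
  rw [Real.exp_lt_one_iff]; linarith [hh_pos v]

lemma polyLog_one_hh (v : ℝ) : polyLog 1 (Real.exp (-hh v)) = 2 * v + hh v := by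
  have h := Real.hasSum_pow_div_log_of_abs_lt_one (x := Real.exp (-hh v))
    (by rw [abs_of_pos (Real.exp_pos _)]; exact y_lt v)
  have h2 := kk_phi2 v
  unfold kk at h2
  rw [show -2 * (hh v / 2) = -hh v by ring] at h2
  unfold polyLog
  simp only [pow_one]
  rw [h.tsum_eq, h2]
  ring

lemma D_deriv (m : ℕ) (v d : ℝ) (hd : HasDerivAt hh d v) :
    HasDerivAt (fun v => polyLog (m + 1) (Real.exp (-hh v)))
      (-d * polyLog m (Real.exp (-hh v))) v := by
  have h := (polyLog_deriv m _ (Real.exp_pos (-hh v)) (y_lt v)).comp v hd.fun_neg.exp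
  refine HasDerivAt.congr_deriv h ?_
  field_simp

lemma hh_tendsto : Tendsto hh atTop (𝓝 0) := by
  refine hh_O.trans_tendsto ?_
  exact Real.tendsto_exp_atBot.comp (tendsto_id.const_mul_atTop_of_neg (by norm_num))

lemma vh_tendsto (n : ℕ) (hn : 1 ≤ n) : Tendsto (fun v => v * hh v ^ n) atTop (𝓝 0) := by
  have := (pow_O hh hh_O 1 n hn).trans_tendsto
    (Real.tendsto_exp_atBot.comp (tendsto_id.const_mul_atTop_of_neg (by norm_num)))
  simpa using this

lemma D_tendsto (m : ℕ) (hm : 2 ≤ m) :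
    Tendsto (fun v => polyLog m (Real.exp (-hh v))) atTop (𝓝 (zetaVal m)) := by
  rw [← polyLog_one_arg]
  have h := (polyLog_cont m hm) 1 (by simp)
  refine h.tendsto.comp (tendsto_nhdsWithin_iff.2 ⟨?_, ?_⟩)
  · have := (Real.continuous_exp.tendsto _).comp hh_tendsto.neg
    rw [neg_zero, Real.exp_zero] at this
    exact this
  · exact Eventually.of_forall fun v => ⟨(Real.exp_pos _).le, (y_lt v).le⟩

lemma hh_zero : hh 0 = Real.log 2 := by unfold hh; norm_num

lemma exp_hh_zero : Real.exp (-hh 0) = 1 / 2 := by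
  rw [hh_zero, Real.exp_neg, Real.exp_log (by norm_num)]; norm_num

lemma HH_ftc (n : ℕ) (hn : 1 ≤ n) (P : ℝ → ℝ) (m : ℝ)
    (hP : ∀ v d, HasDerivAt hh d v → HasDerivAt P (-2 * hh v ^ n) v)
    (hm : Tendsto P atTop (𝓝 m)) : 2 * HH 0 n = P 0 - m := by
  have h := integral_Ioi_of_hasDerivAt_of_tendsto' (a := (0 : ℝ)) (fun v _ => hP v _ (hh_deriv v))
    (by simpa [IntegrableOn] using (hh_int 0 n hn).const_mul (-2)) hm
  rw [integral_const_mul] at h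
  unfold HH
  simp only [pow_zero, one_mul]
  linarith

lemma P1 : 2 * HH 0 1 = zetaVal 2 - polyLog 2 (1 / 2) - Real.log 2 ^ 2 + Real.log 2 ^ 2 / 2 := by
  have h := HH_ftc 1 le_rfl (fun v => hh v ^ 2 / 2 - hh v ^ 1 * (2 * v + hh v)
    - polyLog 2 (Real.exp (-hh v))) (- zetaVal 2) ?_ ?_
  · rw [h]
    rw [exp_hh_zero, hh_zero]; ring
  · intro v d hd
    have h1 := ((((hd.fun_pow 2).div_const 2).fun_sub ((hd.fun_pow 1).fun_mul
      (((hasDerivAt_id' v).const_mul 2).fun_add hd))).fun_sub (D_deriv 1 v d hd))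
    refine h1.congr_deriv ?_
    rw [polyLog_one_hh]
    norm_num
    ring
  · have h1 := ((((hh_tendsto.pow 2).mul_const (1 / 2)).sub
      (((vh_tendsto 1 (by norm_num)).const_mul 2).add (hh_tendsto.pow 2))).sub (D_tendsto 2 (by norm_num)))
    convert h1 using 2
    · ring
    · norm_num

lemma P2 : 2 * HH 0 2 = 2 * zetaVal 3 - 2 * polyLog 3 (1 / 2) - 2 * Real.log 2 * polyLog 2 (1 / 2)
    - Real.log 2 ^ 3 + Real.log 2 ^ 3 / 3 := by
  have h := HH_ftc 2 (by norm_num) (fun v => hh v ^ 3 / 3 - hh v ^ 2 * (2 * v + hh v)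
    - 2 * (hh v ^ 1 * polyLog 2 (Real.exp (-hh v)))
    - 2 * polyLog 3 (Real.exp (-hh v))) (- (2 * zetaVal 3)) ?_ ?_
  · rw [h]
    rw [exp_hh_zero, hh_zero]; ring
  · intro v d hd
    have h1 := (((((hd.fun_pow 3).div_const 3).fun_sub ((hd.fun_pow 2).fun_mul
      (((hasDerivAt_id' v).const_mul 2).fun_add hd))).fun_sub
      (((hd.fun_pow 1).fun_mul (D_deriv 1 v d hd)).const_mul 2)).fun_sub
      ((D_deriv 2 v d hd).const_mul 2))
    refine h1.congr_deriv ?_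
    rw [polyLog_one_hh]
    norm_num
    ring
  · have h1 := (((((hh_tendsto.pow 3).mul_const (1 / 3)).sub
      (((vh_tendsto 2 (by norm_num)).const_mul 2).add (hh_tendsto.pow 3))).sub
      (((hh_tendsto.pow 1).mul (D_tendsto 2 (by norm_num))).const_mul 2)).sub
      ((D_tendsto 3 (by norm_num)).const_mul 2))
    convert h1 using 2
    · ring
    · norm_num

lemma P3 : 2 * HH 0 3 = 6 * zetaVal 4 - 6 * polyLog 4 (1 / 2) - 6 * Real.log 2 * polyLog 3 (1 / 2)
    - 3 * Real.log 2 ^ 2 * polyLog 2 (1 / 2)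
    - Real.log 2 ^ 4 + Real.log 2 ^ 4 / 4 := by
  have h := HH_ftc 3 (by norm_num) (fun v => hh v ^ 4 / 4 - hh v ^ 3 * (2 * v + hh v)
    - 3 * (hh v ^ 2 * polyLog 2 (Real.exp (-hh v)))
    - 6 * (hh v ^ 1 * polyLog 3 (Real.exp (-hh v)))
    - 6 * polyLog 4 (Real.exp (-hh v))) (- (6 * zetaVal 4)) ?_ ?_
  · rw [h]
    rw [exp_hh_zero, hh_zero]; ring
  · intro v d hd
    have h1 := ((((((hd.fun_pow 4).div_const 4).fun_sub ((hd.fun_pow 3).fun_mul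
      (((hasDerivAt_id' v).const_mul 2).fun_add hd))).fun_sub
      (((hd.fun_pow 2).fun_mul (D_deriv 1 v d hd)).const_mul 3)).fun_sub
      (((hd.fun_pow 1).fun_mul (D_deriv 2 v d hd)).const_mul 6)).fun_sub
      ((D_deriv 3 v d hd).const_mul 6))
    refine h1.congr_deriv ?_
    rw [polyLog_one_hh]
    norm_num
    ring
  · have h1 := ((((((hh_tendsto.pow 4).mul_const (1 / 4)).sub
      (((vh_tendsto 3 (by norm_num)).const_mul 2).add (hh_tendsto.pow 4))).sub
      (((hh_tendsto.pow 2).mul (D_tendsto 2 (by norm_num))).const_mul 3)).sub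
      (((hh_tendsto.pow 1).mul (D_tendsto 3 (by norm_num))).const_mul 6)).sub
      ((D_tendsto 4 (by norm_num)).const_mul 6))
    convert h1 using 2
    · ring
    · norm_num

lemma P4 : 2 * HH 0 4 = 24 * zetaVal 5 - 24 * polyLog 5 (1 / 2)
    - 24 * Real.log 2 * polyLog 4 (1 / 2)
    - 12 * Real.log 2 ^ 2 * polyLog 3 (1 / 2)
    - 4 * Real.log 2 ^ 3 * polyLog 2 (1 / 2)
    - Real.log 2 ^ 5 + Real.log 2 ^ 5 / 5 := by
  have h := HH_ftc 4 (by norm_num) (fun v => hh v ^ 5 / 5 - hh v ^ 4 * (2 * v + hh v)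
    - 4 * (hh v ^ 3 * polyLog 2 (Real.exp (-hh v)))
    - 12 * (hh v ^ 2 * polyLog 3 (Real.exp (-hh v)))
    - 24 * (hh v ^ 1 * polyLog 4 (Real.exp (-hh v)))
    - 24 * polyLog 5 (Real.exp (-hh v))) (- (24 * zetaVal 5)) ?_ ?_
  · rw [h]
    rw [exp_hh_zero, hh_zero]; ring
  · intro v d hd
    have h1 := (((((((hd.fun_pow 5).div_const 5).fun_sub ((hd.fun_pow 4).fun_mul
      (((hasDerivAt_id' v).const_mul 2).fun_add hd))).fun_sub
      (((hd.fun_pow 3).fun_mul (D_deriv 1 v d hd)).const_mul 4)).fun_sub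
      (((hd.fun_pow 2).fun_mul (D_deriv 2 v d hd)).const_mul 12)).fun_sub
      (((hd.fun_pow 1).fun_mul (D_deriv 3 v d hd)).const_mul 24)).fun_sub
      ((D_deriv 4 v d hd).const_mul 24))
    refine h1.congr_deriv ?_
    rw [polyLog_one_hh]
    norm_num
    ring
  · have h1 := (((((((hh_tendsto.pow 5).mul_const (1 / 5)).sub
      (((vh_tendsto 4 (by norm_num)).const_mul 2).add (hh_tendsto.pow 5))).sub
      (((hh_tendsto.pow 3).mul (D_tendsto 2 (by norm_num))).const_mul 4)).sub
      (((hh_tendsto.pow 2).mul (D_tendsto 3 (by norm_num))).const_mul 12)).sub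
      (((hh_tendsto.pow 1).mul (D_tendsto 4 (by norm_num))).const_mul 24)).sub
      ((D_tendsto 5 (by norm_num)).const_mul 24))
    convert h1 using 2
    · ring
    · norm_num

lemma zeta2 : zetaVal 2 = π ^ 2 / 6 := by
  have h := (hasSum_nat_add_iff' 1).2 hasSum_zeta_two
  simp at h
  unfold zetaVal
  rw [← h.tsum_eq]
  simp

lemma zeta4 : zetaVal 4 = π ^ 4 / 90 := by
  have h := (hasSum_nat_add_iff' 1).2 hasSum_zeta_four
  simp at h
  unfold zetaVal
  rw [← h.tsum_eq]
  simp

lemma I_eq : ∫ x in (0 : ℝ)..(π / 2), x * (Real.log (Real.sin x)) ^ 3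
    = SS 1 3 - 3 * Real.log 2 * SS 1 2 + 3 * Real.log 2 ^ 2 * SS 1 1 - Real.log 2 ^ 3 * SS 1 0 := by
  have h := (SS_lin [(1, 1, 3), (-3 * Real.log 2, 1, 2), (3 * Real.log 2 ^ 2, 1, 1),
    (-Real.log 2 ^ 3, 1, 0)] (by simp)).2
  simp only [lin_cons, lin_nil] at h
  have e : ∫ x in (0 : ℝ)..(π / 2), x * (Real.log (Real.sin x)) ^ 3 =
      lin SS [(1, 1, 3), (-3 * Real.log 2, 1, 2), (3 * Real.log 2 ^ 2, 1, 1),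
        (-Real.log 2 ^ 3, 1, 0)] := by
    simp only [lin_cons, lin_nil]
    rw [← h]
    refine intervalIntegral.integral_congr fun x hx => ?_
    rw [uIcc_of_le (by positivity)] at hx
    rcases hx.1.eq_or_lt with h0 | h0
    · rw [← h0]; simp
    · have hs : 0 < Real.sin x := Real.sin_pos_of_pos_of_lt_pi h0 (by linarith [hx.2, pi_pos])
      have : LL x = Real.log 2 + Real.log (Real.sin x) := by
        unfold LL; rw [Real.log_mul (by norm_num) hs.ne']
      rw [this]
      ring
  rw [e]
  simp only [lin_cons, lin_nil]
  ring

set_option maxHeartbeats 4000000 in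
theorem main :
    ∫ x in (0 : ℝ)..(π / 2), x * (Real.log (Real.sin x)) ^ 3
    = -(93 / 128) * zetaVal 5 - 9 / 8 * zetaVal 2 * zetaVal 3 + 3 * polyLog 5 (1 / 2)
      + 57 / 32 * Real.log 2 * zetaVal 4 - 1 / 2 * Real.log 2 ^ 3 * zetaVal 2 - 1 / 40 * Real.log 2 ^ 5 := by
  have hpi : π ≠ 0 := pi_ne_zero
  have S10 : SS 1 0 = π ^ 2 / 8 := by rw [SS_zero]; norm_num; ring
  have S20 : SS 2 0 = π ^ 3 / 24 := by rw [SS_zero]; norm_num; ring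
  have S30 : SS 3 0 = π ^ 4 / 64 := by rw [SS_zero]; norm_num; ring
  have S40 : SS 4 0 = π ^ 5 / 160 := by rw [SS_zero]; norm_num; ring
  have K11 : KK 1 1 = -(1 / 4) * zetaVal 3 := by
    rw [KK_one 1 le_rfl]; norm_num [Nat.factorial]
  have K21 : KK 2 1 = -(1 / 4) * (π ^ 4 / 90) := by
    rw [KK_one 2 (by norm_num), zeta4]; norm_num [Nat.factorial]
  have K31 : KK 3 1 = -(3 / 8) * zetaVal 5 := by
    rw [KK_one 3 (by norm_num)]; norm_num [Nat.factorial]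
  have H11 : HH 1 1 = 3 / 16 * zetaVal 3 := by
    rw [HH_one 1 le_rfl, K11]; ring
  have H21 : HH 2 1 = 7 / 32 * (π ^ 4 / 90) := by
    rw [HH_one 2 (by norm_num), K21]; ring
  have H31 : HH 3 1 = 45 / 128 * zetaVal 5 := by
    rw [HH_one 3 (by norm_num), K31]; ring
  have H01 : HH 0 1 = π ^ 2 / 24 := by
    have h := r_im_11
    rw [S10, S20] at h
    apply mul_left_cancel₀ hpi
    linarith
  have S11 : SS 1 1 = 7 / 16 * zetaVal 3 := by
    have h := r_re_11
    rw [H11, K11] at h; linarith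
  have S21 : SS 2 1 = π * (3 / 16 * zetaVal 3) := by
    have h := r_re_21
    rw [H11] at h; linarith
  have S31 : SS 3 1 = 9 / 64 * π ^ 2 * zetaVal 3 - 93 / 128 * zetaVal 5 := by
    have h := r_re_31
    rw [H11, H31, K31] at h; linarith
  have S41 : SS 4 1 = 3 / 32 * π ^ 3 * zetaVal 3 - 45 / 64 * π * zetaVal 5 := by
    have h := r_re_41
    rw [H11, H31] at h; linarith
  have H02 : HH 0 2 = 1 / 8 * zetaVal 3 := by
    have h := r_im_12
    rw [S11, S21] at h
    apply mul_left_cancel₀ hpi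
    linarith
  have H22 : HH 2 2 = π ^ 2 * zetaVal 3 / 24 + 2 / 3 * (-45 / 32 + 93 / 128) * zetaVal 5 := by
    have h := r_im_32
    rw [S41, S31, H02] at h
    apply mul_left_cancel₀ hpi
    linarith
  have K22 : KK 2 2 = HH 2 2 - 2 * SS 3 1 + π * SS 2 1 - π ^ 2 / 4 * HH 0 2 := by
    linarith [r_im_22]
  rw [H22, S31, S21, H02] at K22
  have L2 : polyLog 2 (1 / 2) = π ^ 2 / 12 - Real.log 2 ^ 2 / 2 := by
    have h := P1
    rw [H01, zeta2] at h; linarith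
  have L3 : polyLog 3 (1 / 2) = 7 / 8 * zetaVal 3 - π ^ 2 / 12 * Real.log 2 + Real.log 2 ^ 3 / 6 := by
    have h := P2
    rw [H02, L2] at h; linarith
  have H03 := P3
  rw [L2, L3, zeta4] at H03
  have H04 := P4
  rw [L2, L3] at H04
  have H13 : HH 1 3 = KK 2 2 - HH 2 2 - HH 0 4 / 4 := by linear_combination (-1 / 4) * t5
  have K13 : KK 1 3 = -4 * KK 3 1 - 4 * HH 1 3 - HH 0 4 - 6 * HH 2 2 - 4 * HH 3 1 := by
    linear_combination (-1 / 2) * t6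
  have S13 : SS 1 3 = 3 * SS 3 1 - 3 * π * SS 2 1 + 3 * π ^ 2 / 4 * SS 1 1 + HH 1 3 - KK 1 3 := by
    linear_combination r_re_13
  have K12 : KK 1 2 = 3 * HH 1 2 + 2 * HH 2 1 + HH 0 3 + 2 * KK 2 1 := by linear_combination (-1 / 2) * t4
  have S12 : SS 1 2 = HH 1 2 - KK 1 2 + SS 3 0 - π * SS 2 0 + π ^ 2 / 4 * SS 1 0 := by
    linear_combination r_re_12
  have S22 : SS 2 2 = π * HH 1 2 + SS 4 0 - π * SS 3 0 + π ^ 2 / 4 * SS 2 0 := by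
    linear_combination r_re_22
  have h := r_im_13
  rw [S22, S12, K12, S10, S20, S30, S40, H21, K21] at h
  have H12 : 6 * HH 1 2 = -(2 * HH 0 3) + π ^ 4 / 240 := by
    apply mul_left_cancel₀ hpi
    linear_combination h
  have H12' : HH 1 2 = (-(2 * HH 0 3) + π ^ 4 / 240) / 6 := by linear_combination H12 / 6
  have H03' : HH 0 3 = (2 * HH 0 3) / 2 := by ring
  have H04' : HH 0 4 = (2 * HH 0 4) / 2 := by ring
  rw [H03] at H03'
  rw [H04] at H04'
  rw [I_eq, S13, S12, K13, H13, K12, H12', H04', H03', K22, H22, S31, S21, S11, S10, S20, S30, H21, K21,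
    K31, H31, zeta2, zeta4]
  ring

end LogSin

theorem stmt_7 :
    ∫ x in (0 : ℝ)..(π / 2), x * (Real.log (Real.sin x)) ^ 3
    = -(93 / 128) * zetaVal 5 - 9 / 8 * zetaVal 2 * zetaVal 3 + 3 * polyLog 5 (1 / 2)
      + 57 / 32 * Real.log 2 * zetaVal 4 - 1 / 2 * Real.log 2 ^ 3 * zetaVal 2 - 1 / 40 * Real.log 2 ^ 5 := by
  exact LogSin.main
end

section
/- ∫_0^{π/2} x ln(sin(x)) ln^2(cos(x)) dx = (155/128)ζ(5) + (13/32)ζ(2)ζ(3) − Li_5(1/2) − (49/32) ln(2) ζ(4) − (5/6) ln^3(2) ζ(2) + (1/120) ln^5(2). -/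
open Real

section

open MeasureTheory Set Filter Topology

lemma aux_exp_image : (fun τ : ℝ => Real.exp (-τ)) '' Ioi 0 = Ioo 0 1 := by
  ext s
  simp only [mem_image, mem_Ioi, mem_Ioo]
  constructor
  · rintro ⟨t, ht, rfl⟩
    exact ⟨Real.exp_pos _, by simpa using ht⟩
  · rintro ⟨h0, h1⟩
    exact ⟨-Real.log s, by simpa using Real.log_neg h0 h1, by simp [Real.exp_log h0]⟩

lemma aux_exp_int (k n : ℕ) :
    IntegrableOn (fun τ : ℝ => τ ^ k * Real.exp (-(((n : ℝ) + 1) * τ))) (Ioi 0) ∧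
    ∫ τ in Ioi (0 : ℝ), τ ^ k * Real.exp (-(((n : ℝ) + 1) * τ)) = (k.factorial : ℝ) / ((n : ℝ) + 1) ^ (k + 1) := by
  constructor
  · have := integrableOn_rpow_mul_exp_neg_mul_rpow (p := 1) (s := k) (b := (n : ℝ) + 1)
      (by have : (0 : ℝ) ≤ k := by positivity
          linarith) one_pos (by positivity)
    refine this.congr_fun (fun x _ => ?_) measurableSet_Ioi
    simp only [Real.rpow_natCast, Real.rpow_one, neg_mul]
  · have := Real.integral_rpow_mul_exp_neg_mul_Ioi (a := (k : ℝ) + 1) (r := (n : ℝ) + 1) (by positivity) (by positivity)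
    rw [Real.Gamma_nat_eq_factorial] at this
    have h2 : ((k : ℝ) + 1) = ((k + 1 : ℕ) : ℝ) := by push_cast; ring
    rw [add_sub_cancel_right, h2] at this
    simp only [Real.rpow_natCast] at this
    rw [this, div_pow, one_pow]
    field_simp

lemma logpow_int (k n : ℕ) :
    IntegrableOn (fun s : ℝ => s ^ n * Real.log s ^ k) (Ioo 0 1) ∧
    ∫ s in Ioo (0 : ℝ) 1, s ^ n * Real.log s ^ k = (-1) ^ k * (k.factorial : ℝ) / ((n : ℝ) + 1) ^ (k + 1) := by
  have hd : ∀ x ∈ Ioi (0 : ℝ), HasDerivWithinAt (fun τ : ℝ => Real.exp (-τ)) (-Real.exp (-x)) (Ioi 0) x := by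
    intro x _
    have := ((hasDerivAt_id x).neg.exp).hasDerivWithinAt (s := Ioi 0)
    simpa using this
  have hi : InjOn (fun τ : ℝ => Real.exp (-τ)) (Ioi 0) := by
    intro a _ b _ h
    simpa using h
  have e : ∀ x : ℝ, |(-Real.exp (-x))| • (Real.exp (-x) ^ n * Real.log (Real.exp (-x)) ^ k)
      = (-1) ^ k * (x ^ k * Real.exp (-(((n : ℝ) + 1) * x))) := by
    intro x
    rw [abs_neg, abs_of_pos (Real.exp_pos _), Real.log_exp, ← Real.exp_nat_mul, smul_eq_mul, neg_pow]
    have : -(((n : ℝ) + 1) * x) = -x + n * -x := by ring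
    rw [this, Real.exp_add]
    ring
  rw [← aux_exp_image]
  constructor
  · rw [integrableOn_image_iff_integrableOn_abs_deriv_smul measurableSet_Ioi hd hi]
    simp only [e]
    exact (aux_exp_int k n).1.const_mul _
  · rw [integral_image_eq_integral_abs_deriv_smul measurableSet_Ioi hd hi]
    simp only [e]
    rw [integral_const_mul, (aux_exp_int k n).2]
    ring

lemma log_pow_integrable (k : ℕ) : IntegrableOn (fun s : ℝ => |Real.log s| ^ k) (Ioo 0 1) := by
  have : IntegrableOn (fun s : ℝ => ‖s ^ 0 * Real.log s ^ k‖) (Ioo 0 1) := (logpow_int k 0).1.norm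
  refine this.congr_fun (fun x _ => ?_) measurableSet_Ioo
  simp

lemma abs_log_div_bound {s : ℝ} (hs : s ∈ Ioo (0 : ℝ) 1) (k : ℕ) :
    |Real.log s| ^ (k + 1) / (1 - s) ≤ 2 * (|Real.log s| ^ k + |Real.log s| ^ (k + 1)) := by
  obtain ⟨h0, h1⟩ := hs
  have h1' : 0 < 1 - s := by linarith
  rw [div_le_iff₀ h1']
  have hp : 0 ≤ |Real.log s| ^ k := by positivity
  have hq : 0 ≤ |Real.log s| ^ (k + 1) := by positivity
  rcases le_total s (1 / 2) with h | h
  · nlinarith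
  · have hl : |Real.log s| ≤ 2 * (1 - s) := by
      rw [abs_of_neg (Real.log_neg h0 h1)]
      have := Real.one_sub_inv_le_log_of_pos h0
      have h3 : s⁻¹ - 1 ≤ 2 * (1 - s) := by
        have : s⁻¹ - 1 = (1 - s) * s⁻¹ := by field_simp
        rw [this, mul_comm 2]
        refine mul_le_mul_of_nonneg_left ?_ h1'.le
        rw [inv_le_comm₀ h0 (by norm_num)]; linarith
      linarith
    have : |Real.log s| ^ (k + 1) ≤ |Real.log s| ^ k * (2 * (1 - s)) := by
      rw [pow_succ]; exact mul_le_mul_of_nonneg_left hl hp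
    nlinarith

lemma log_div_integrable (k : ℕ) : IntegrableOn (fun s : ℝ => |Real.log s| ^ (k + 1) / (1 - s)) (Ioo 0 1) := by
  refine Integrable.mono' (((log_pow_integrable k).add (log_pow_integrable (k + 1))).const_mul 2) ?_ ?_
  · exact (by fun_prop : Measurable fun s : ℝ => |Real.log s| ^ (k + 1) / (1 - s)).aestronglyMeasurable
  · refine (ae_restrict_iff' measurableSet_Ioo).2 (Eventually.of_forall fun s hs => ?_)
    rw [Real.norm_of_nonneg (div_nonneg (by positivity) (by linarith [hs.2]))]
    exact abs_log_div_bound hs k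

lemma one_sub_mul_pos {c s : ℝ} (hc : |c| ≤ 1) (hs : s ∈ Ioo (0 : ℝ) 1) : 1 - s ≤ 1 - c * s := by
  have := (abs_le.1 hc).2
  nlinarith [hs.1, hs.2]

lemma zsum_summable (m : ℕ) (hm : 2 ≤ m) (c : ℝ) (hc : |c| ≤ 1) :
    Summable (fun n : ℕ => c ^ n / ((n : ℝ) + 1) ^ m) := by
  have h : Summable (fun n : ℕ => 1 / ((n : ℝ) + 1) ^ m) := by
    have := (summable_nat_add_iff (f := fun n : ℕ => 1 / (n : ℝ) ^ m) 1).2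
      (Real.summable_one_div_nat_pow.2 (by omega))
    simpa using this
  refine Summable.of_norm_bounded h fun n => ?_
  rw [norm_div, norm_pow, Real.norm_eq_abs, Real.norm_of_nonneg (by positivity : (0 : ℝ) ≤ ((n : ℝ) + 1) ^ m)]
  gcongr
  exact pow_le_one₀ (abs_nonneg _) hc

lemma polylog_int (k : ℕ) (c : ℝ) (hc : |c| ≤ 1) :
    IntegrableOn (fun s : ℝ => Real.log s ^ (k + 1) / (1 - c * s)) (Ioo 0 1) ∧
    ∫ s in Ioo (0 : ℝ) 1, Real.log s ^ (k + 1) / (1 - c * s)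
      = (-1) ^ (k + 1) * ((k + 1).factorial : ℝ) * ∑' n : ℕ, c ^ n / ((n : ℝ) + 1) ^ (k + 2) := by
  constructor
  · refine Integrable.mono' (log_div_integrable k) ?_ ?_
    · exact (by fun_prop : Measurable fun s : ℝ => Real.log s ^ (k + 1) / (1 - c * s)).aestronglyMeasurable
    · refine (ae_restrict_iff' measurableSet_Ioo).2 (Eventually.of_forall fun s hs => ?_)
      have h1 := one_sub_mul_pos hc hs
      have h2 : 0 < 1 - s := by linarith [hs.2]
      rw [norm_div, norm_pow, Real.norm_eq_abs, Real.norm_of_nonneg (by linarith : 0 ≤ 1 - c * s)]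
      gcongr
  · have hF : ∀ n : ℕ, Integrable (fun s : ℝ => c ^ n * (s ^ n * Real.log s ^ (k + 1)))
        (volume.restrict (Ioo 0 1)) := fun n => (logpow_int (k + 1) n).1.const_mul _
    have hn : ∀ n : ℕ, ∫ s in Ioo (0 : ℝ) 1, ‖c ^ n * (s ^ n * Real.log s ^ (k + 1))‖
        = ((k + 1).factorial : ℝ) * (|c| ^ n / ((n : ℝ) + 1) ^ (k + 2)) := by
      intro n
      have : ∫ s in Ioo (0 : ℝ) 1, ‖c ^ n * (s ^ n * Real.log s ^ (k + 1))‖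
          = ∫ s in Ioo (0 : ℝ) 1, (|c| ^ n * (-1) ^ (k + 1)) * (s ^ n * Real.log s ^ (k + 1)) := by
        refine setIntegral_congr_fun measurableSet_Ioo fun s hs => ?_
        simp only [norm_mul, norm_pow, Real.norm_eq_abs]
        rw [abs_of_pos hs.1, abs_of_neg (Real.log_neg hs.1 hs.2), neg_pow (Real.log s)]
        ring
      rw [this, integral_const_mul, (logpow_int (k + 1) n).2]
      have h1 : ((-1 : ℝ) ^ (k + 1)) * (-1) ^ (k + 1) = 1 := by
        rw [← mul_pow]; simp
      calc _ = (((-1 : ℝ) ^ (k + 1)) * (-1) ^ (k + 1)) * (((k + 1).factorial : ℝ) * (|c| ^ n / ((n : ℝ) + 1) ^ (k + 2))) := by ring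
        _ = _ := by rw [h1, one_mul]
    have hs := hasSum_integral_of_summable_integral_norm hF (by
      simp only [hn]
      exact (zsum_summable (k + 2) (by omega) |c| (by simpa using hc)).mul_left _)
    have h2 : ∫ s in Ioo (0 : ℝ) 1, Real.log s ^ (k + 1) / (1 - c * s)
        = ∫ s in Ioo (0 : ℝ) 1, ∑' n : ℕ, c ^ n * (s ^ n * Real.log s ^ (k + 1)) := by
      refine setIntegral_congr_fun measurableSet_Ioo fun s hs => ?_
      have hlt : ‖c * s‖ < 1 := by
        rw [norm_mul, Real.norm_eq_abs, Real.norm_of_nonneg hs.1.le]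
        calc |c| * s ≤ 1 * s := by gcongr; exact hs.1.le
          _ < 1 := by linarith [hs.2]
      have := (hasSum_geometric_of_norm_lt_one hlt).mul_right (Real.log s ^ (k + 1))
      rw [div_eq_inv_mul, ← this.tsum_eq]
      congr 1; ext n; rw [mul_pow]; ring
    rw [h2, ← hs.tsum_eq, ← tsum_mul_left]
    congr 1; ext n
    rw [integral_const_mul, (logpow_int (k + 1) n).2]
    ring

lemma zeta_tsum (m : ℕ) : ∑' n : ℕ, (1 : ℝ) ^ n / ((n : ℝ) + 1) ^ m = zetaVal m := by
  simp [zetaVal]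

lemma eta_tsum (m : ℕ) (hm : 2 ≤ m) :
    ∑' n : ℕ, (-1 : ℝ) ^ n / ((n : ℝ) + 1) ^ m = (1 - 2 / 2 ^ m) * zetaVal m := by
  have hs1 := zsum_summable m hm 1 (by simp)
  have hs2 := zsum_summable m hm (-1) (by simp)
  have hodd : ∀ c : ℝ, |c| ≤ 1 → Summable (fun n : ℕ => c ^ n / ((n : ℝ) + 1) ^ m) →
     ∑' n : ℕ, c ^ (2 * n) / (((2 * n : ℕ) : ℝ) + 1) ^ m + ∑' n : ℕ, c ^ (2 * n + 1) / (((2 * n + 1 : ℕ) : ℝ) + 1) ^ m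
       = ∑' n : ℕ, c ^ n / ((n : ℝ) + 1) ^ m := by
    intro c _ h
    have e1 : Function.Injective (fun n : ℕ => 2 * n) := fun a b h => by simpa using h
    have e2 : Function.Injective (fun n : ℕ => 2 * n + 1) := fun a b h => by simpa using h
    exact tsum_even_add_odd (f := fun n : ℕ => c ^ n / ((n : ℝ) + 1) ^ m) (h.comp_injective e1)
      (h.comp_injective e2)
  have h1 := hodd 1 (by simp) hs1
  have h2 := hodd (-1) (by simp) hs2
  have h3 : ∑' n : ℕ, (1 : ℝ) ^ (2 * n + 1) / (((2 * n + 1 : ℕ) : ℝ) + 1) ^ m = 1 / 2 ^ m * zetaVal m := by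
    rw [← zeta_tsum, ← tsum_mul_left]
    congr 1; ext n
    have : (((2 * n + 1 : ℕ) : ℝ) + 1) = 2 * (n + 1) := by push_cast; ring
    rw [this, mul_pow]; simp [mul_comm]
  have h4 : ∑' n : ℕ, (-1 : ℝ) ^ (2 * n + 1) / (((2 * n + 1 : ℕ) : ℝ) + 1) ^ m
      = - ∑' n : ℕ, (1 : ℝ) ^ (2 * n + 1) / (((2 * n + 1 : ℕ) : ℝ) + 1) ^ m := by
    rw [← tsum_neg]
    congr 1; ext n
    rw [pow_succ, pow_mul]; simp [neg_div]
  have h5 : ∑' n : ℕ, (-1 : ℝ) ^ (2 * n) / (((2 * n : ℕ) : ℝ) + 1) ^ m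
      = ∑' n : ℕ, (1 : ℝ) ^ (2 * n) / (((2 * n : ℕ) : ℝ) + 1) ^ m := by
    congr 1; ext n
    rw [pow_mul]; simp
  rw [zeta_tsum] at h1
  rw [h4, h5, h3] at h2
  rw [h3] at h1
  rw [← h2]
  linear_combination h1

lemma zeta2_val : zetaVal 2 = π ^ 2 / 6 := by
  have h := hasSum_zeta_two.summable.tsum_eq_zero_add
  rw [hasSum_zeta_two.tsum_eq] at h
  rw [h, zetaVal]; simp

lemma zeta4_val : zetaVal 4 = π ^ 4 / 90 := by
  have h := hasSum_zeta_four.summable.tsum_eq_zero_add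
  rw [hasSum_zeta_four.tsum_eq] at h
  rw [h, zetaVal]; simp

lemma cv_hyps : (∀ s ∈ Ioo (0 : ℝ) 1, HasDerivWithinAt (fun s : ℝ => (1 - s) / (1 + s)) (-2 / (1 + s) ^ 2) (Ioo 0 1) s) ∧
    InjOn (fun s : ℝ => (1 - s) / (1 + s)) (Ioo 0 1) ∧
    (fun s : ℝ => (1 - s) / (1 + s)) '' (Ioo 0 1) = Ioo 0 1 := by
  refine ⟨fun s hs => ?_, fun a ha b hb h => ?_, ?_⟩
  · have h1 : (1 + s) ≠ 0 := by linarith [hs.1]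
    have := (((hasDerivAt_id s).const_sub 1).div ((hasDerivAt_id s).const_add 1) h1).hasDerivWithinAt (s := Ioo 0 1)
    refine this.congr_deriv ?_
    simp only [id]
    congr 1
    ring
  · have h1 : (1 + a) ≠ 0 := by linarith [ha.1]
    have h2 : (1 + b) ≠ 0 := by linarith [hb.1]
    simp only at h
    rw [div_eq_div_iff h1 h2] at h
    linarith
  · ext t
    simp only [mem_image, mem_Ioo]
    constructor
    · rintro ⟨s, ⟨h0, h1⟩, rfl⟩
      refine ⟨div_pos (by linarith) (by linarith), ?_⟩
      rw [div_lt_one (by linarith)]; linarith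
    · rintro ⟨h0, h1⟩
      refine ⟨(1 - t) / (1 + t), ⟨div_pos (by linarith) (by linarith), ?_⟩, ?_⟩
      · rw [div_lt_one (by linarith)]; linarith
      · have : 1 + t ≠ 0 := by linarith
        field_simp
        ring

lemma cv_mobius (g h : ℝ → ℝ) (hg : ∀ s ∈ Ioo (0 : ℝ) 1, g ((1 - s) / (1 + s)) * (2 / (1 - s ^ 2)) = h s) :
    (IntegrableOn (fun t => g t / t) (Ioo 0 1) ↔ IntegrableOn h (Ioo 0 1)) ∧
    ∫ t in Ioo (0 : ℝ) 1, g t / t = ∫ s in Ioo (0 : ℝ) 1, h s := by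
  obtain ⟨hd, hi, him⟩ := cv_hyps
  have e : EqOn (fun s => |(-2 / (1 + s) ^ 2 : ℝ)| • (g ((1 - s) / (1 + s)) / ((1 - s) / (1 + s)))) h (Ioo 0 1) := by
    intro s hs
    rw [← hg s hs]
    have h1 : 0 < 1 + s := by linarith [hs.1]
    have h2 : 0 < 1 - s := by linarith [hs.2]
    have h3 : 1 - s ^ 2 ≠ 0 := by nlinarith
    have : |(-2 / (1 + s) ^ 2 : ℝ)| = 2 / (1 + s) ^ 2 := by
      rw [abs_div, abs_neg, abs_of_pos (by norm_num : (0 : ℝ) < 2), abs_of_pos (by positivity)]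
    simp only [this, smul_eq_mul]
    have h4 : 1 - s ^ 2 = (1 - s) * (1 + s) := by ring
    rw [h4]
    field_simp
  have i1 := integrableOn_image_iff_integrableOn_abs_deriv_smul measurableSet_Ioo hd hi (fun t => g t / t)
  have i2 := integral_image_eq_integral_abs_deriv_smul measurableSet_Ioo hd hi (fun t => g t / t)
  rw [him] at i1 i2
  exact ⟨i1.trans (integrableOn_congr_fun e measurableSet_Ioo), i2.trans (setIntegral_congr_fun measurableSet_Ioo e)⟩

lemma log_sq_int (k : ℕ) :
    IntegrableOn (fun s : ℝ => Real.log s ^ (k + 1) / (1 - s ^ 2)) (Ioo 0 1) ∧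
    ∫ s in Ioo (0 : ℝ) 1, Real.log s ^ (k + 1) / (1 - s ^ 2)
      = (-1) ^ (k + 1) * ((k + 1).factorial : ℝ) * ((1 - 1 / 2 ^ (k + 2)) * zetaVal (k + 2)) := by
  have h1 := polylog_int k 1 (by simp)
  have h2 := polylog_int k (-1) (by simp)
  have e : EqOn (fun s : ℝ => 1 / 2 * (Real.log s ^ (k + 1) / (1 - 1 * s) + Real.log s ^ (k + 1) / (1 - (-1) * s)))
      (fun s : ℝ => Real.log s ^ (k + 1) / (1 - s ^ 2)) (Ioo 0 1) := by
    intro s hs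
    have h1 : 1 + s ≠ 0 := by linarith [hs.1]
    have h2 : 1 - s ≠ 0 := by linarith [hs.2]
    have h4 : 1 - s ^ 2 = (1 - s) * (1 + s) := by ring
    simp only [h4, one_mul, neg_mul, sub_neg_eq_add]
    field_simp
    ring
  constructor
  · have : IntegrableOn (fun s : ℝ => 1 / 2 * (Real.log s ^ (k + 1) / (1 - 1 * s) + Real.log s ^ (k + 1) / (1 - (-1) * s))) (Ioo 0 1) :=
      (h1.1.add h2.1).const_mul _
    exact this.congr_fun e measurableSet_Ioo
  · rw [← setIntegral_congr_fun measurableSet_Ioo e, integral_const_mul, integral_add h1.1 h2.1, h1.2, h2.2,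
      zeta_tsum, eta_tsum _ (by omega)]
    rw [pow_add (2 : ℝ) k 2]
    field_simp
    ring

/-- `∫ (b-a)^3/t`. -/
lemma J3_val : IntegrableOn (fun t : ℝ => (Real.log (1 + t) - Real.log (1 - t)) ^ 3 / t) (Ioo 0 1) ∧
    ∫ t in Ioo (0 : ℝ) 1, (Real.log (1 + t) - Real.log (1 - t)) ^ 3 / t = 45 / 4 * zetaVal 4 := by
  have h := cv_mobius (fun t => (Real.log (1 + t) - Real.log (1 - t)) ^ 3)
    (fun s => -2 * (Real.log s ^ (2 + 1) / (1 - s ^ 2))) (by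
      intro s hs
      have h1 : 0 < 1 + s := by linarith [hs.1]
      have e1 : 1 + (1 - s) / (1 + s) = 2 / (1 + s) := by field_simp; ring
      have e2 : 1 - (1 - s) / (1 + s) = 2 * s / (1 + s) := by field_simp; ring
      simp only [e1, e2]
      rw [Real.log_div (by norm_num) h1.ne', Real.log_div (by nlinarith [hs.1]) h1.ne', Real.log_mul (by norm_num) hs.1.ne']
      ring)
  have h2 := log_sq_int 2
  refine ⟨h.1.2 (h2.1.const_mul _), ?_⟩
  rw [h.2, integral_const_mul, h2.2]
  norm_num [Nat.factorial]
  ring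

lemma Lam_bound {s : ℝ} (hs : s ∈ Ioo (0 : ℝ) 1) :
    0 ≤ 2 * Real.log (1 + s) - 2 * Real.log 2 - Real.log s ∧
    2 * Real.log (1 + s) - 2 * Real.log 2 - Real.log s ≤ |Real.log s| := by
  have h0 := hs.1
  have h1 := hs.2
  have a1 : Real.log (1 + s) ≤ Real.log 2 := Real.log_le_log (by linarith) (by linarith)
  have a2 : 2 * Real.log 2 + Real.log s ≤ 2 * Real.log (1 + s) := by
    have : Real.log (4 * s) ≤ Real.log ((1 + s) ^ 2) := Real.log_le_log (by linarith) (by nlinarith [sq_nonneg (1 - s)])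
    rw [Real.log_mul (by norm_num) h0.ne', Real.log_pow, show (4 : ℝ) = 2 ^ 2 by norm_num, Real.log_pow] at this
    simpa using this
  rw [abs_of_neg (Real.log_neg h0 h1)]
  constructor <;> linarith

lemma Lam_integrable : IntegrableOn (fun s : ℝ => Real.log s ^ 3 * ((2 * Real.log (1 + s) - 2 * Real.log 2 - Real.log s) / (1 - s ^ 2))) (Ioo 0 1) := by
  refine Integrable.mono' (log_div_integrable 3) ?_ ?_
  · exact (by fun_prop : Measurable _).aestronglyMeasurable
  · refine (ae_restrict_iff' measurableSet_Ioo).2 (Eventually.of_forall fun s hs => ?_)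
    have hb := Lam_bound hs
    have h1 : 0 < 1 - s := by linarith [hs.2]
    have h2 : 1 - s ≤ 1 - s ^ 2 := by nlinarith [hs.1, hs.2]
    rw [norm_mul, norm_div, norm_pow, Real.norm_eq_abs, Real.norm_of_nonneg hb.1, Real.norm_of_nonneg (by linarith), ← mul_div_assoc,
      pow_succ _ 3]
    gcongr
    exact hb.2

/-- inner `y` integral -/
lemma kappa_y {s : ℝ} (hs : s ∈ Ioo (0 : ℝ) 1) :
    IntegrableOn (fun y : ℝ => (1 - s) * (1 - y) / ((1 + s) * (1 + y) * (s + y) * (1 + y * s))) (Ioo 0 1) ∧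
    ∫ y in Ioo (0 : ℝ) 1, (1 - s) * (1 - y) / ((1 + s) * (1 + y) * (s + y) * (1 + y * s))
      = (2 * Real.log (1 + s) - 2 * Real.log 2 - Real.log s) / (1 - s ^ 2) := by
  have h0 := hs.1
  have h1 := hs.2
  have hc : ContinuousOn (fun y : ℝ => (1 - s) * (1 - y) / ((1 + s) * (1 + y) * (s + y) * (1 + y * s))) (Icc 0 1) := by
    refine ContinuousOn.div (by fun_prop) (by fun_prop) fun y hy => ?_
    have := hy.1
    positivity
  have hyint : IntervalIntegrable (fun y : ℝ => (1 - s) * (1 - y) / ((1 + s) * (1 + y) * (s + y) * (1 + y * s))) volume 0 1 :=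
    ContinuousOn.intervalIntegrable (by rwa [uIcc_of_le zero_le_one])
  refine ⟨(hc.integrableOn_Icc).mono_set Ioo_subset_Icc_self, ?_⟩
  rw [← integral_Ioc_eq_integral_Ioo, ← intervalIntegral.integral_of_le zero_le_one]
  rw [intervalIntegral.integral_eq_sub_of_hasDerivAt (f := fun y => (Real.log (1 + y * s) + Real.log (s + y) - 2 * Real.log (1 + y)) / (1 - s ^ 2)) _ hyint]
  · simp only [one_mul, zero_mul, add_zero, Real.log_one, zero_add]
    rw [add_comm s 1, show (1 + 1 : ℝ) = 2 by norm_num]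
    ring
  · intro y hy
    rw [uIcc_of_le zero_le_one] at hy
    have hy0 := hy.1
    have p1 : 1 + y * s ≠ 0 := by positivity
    have p2 : s + y ≠ 0 := by positivity
    have p3 : 1 + y ≠ 0 := by positivity
    have p4 : 1 - s ≠ 0 := by linarith
    have p5 : 1 + s ≠ 0 := by linarith
    have d1 : HasDerivAt (fun y : ℝ => 1 + y * s) s y := by simpa using ((hasDerivAt_id y).mul_const s).const_add 1
    have d2 : HasDerivAt (fun y : ℝ => s + y) 1 y := (hasDerivAt_id y).const_add s
    have d3 : HasDerivAt (fun y : ℝ => 1 + y) 1 y := (hasDerivAt_id y).const_add 1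
    have := (((d1.log p1).add (d2.log p2)).sub ((d3.log p3).const_mul 2)).div_const (1 - s ^ 2)
    refine this.congr_deriv ?_
    rw [show 1 - s ^ 2 = (1 - s) * (1 + s) by ring]
    field_simp
    ring

lemma cubic_integrable (l : ℝ) : IntegrableOn (fun v : ℝ => (l + Real.log v) ^ 3 / (1 + v)) (Ioo 0 1) ∧
    IntegrableOn (fun v : ℝ => (Real.log v - l) ^ 3 / (1 + v)) (Ioo 0 1) ∧
    ∫ v in Ioo (0 : ℝ) 1, (l + Real.log v) ^ 3 / (1 + v) + (Real.log v - l) ^ 3 / (1 + v)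
      = 2 * (∫ v in Ioo (0 : ℝ) 1, Real.log v ^ 3 / (1 + v)) - π ^ 2 / 2 * l ^ 2 := by
  have i0 : IntegrableOn (fun v : ℝ => 1 / (1 + v)) (Ioo 0 1) := by
    have : ContinuousOn (fun v : ℝ => 1 / (1 + v)) (Icc 0 1) :=
      ContinuousOn.div (by fun_prop) (by fun_prop) fun y hy => by linarith [hy.1]
    exact this.integrableOn_Icc.mono_set Ioo_subset_Icc_self
  have hp : ∀ k : ℕ, IntegrableOn (fun v : ℝ => Real.log v ^ (k + 1) / (1 + v)) (Ioo 0 1) := by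
    intro k
    have := (polylog_int k (-1) (by simp)).1
    simpa using this
  have i1 := hp 0
  have i2 := hp 1
  have i3 := hp 2
  have v1 : ∫ v in Ioo (0 : ℝ) 1, Real.log v ^ (0 + 1) / (1 + v) = - π ^ 2 / 12 := by
    have := (polylog_int 0 (-1) (by simp)).2
    rw [eta_tsum _ (by omega), zeta2_val] at this
    simp only [neg_mul, one_mul, sub_neg_eq_add] at this
    rw [this]
    norm_num [Nat.factorial]
    ring
  refine ⟨?_, ?_, ?_⟩
  · have : IntegrableOn (fun v : ℝ => l ^ 3 * (1 / (1 + v)) + 3 * l ^ 2 * (Real.log v ^ (0 + 1) / (1 + v))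
        + 3 * l * (Real.log v ^ (1 + 1) / (1 + v)) + Real.log v ^ (2 + 1) / (1 + v)) (Ioo 0 1) :=
      (((i0.const_mul _).add (i1.const_mul _)).add (i2.const_mul _)).add i3
    refine this.congr_fun (fun v _ => ?_) measurableSet_Ioo
    simp only
    ring
  · have : IntegrableOn (fun v : ℝ => (-l ^ 3) * (1 / (1 + v)) + 3 * l ^ 2 * (Real.log v ^ (0 + 1) / (1 + v))
        + (-3 * l) * (Real.log v ^ (1 + 1) / (1 + v)) + Real.log v ^ (2 + 1) / (1 + v)) (Ioo 0 1) :=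
      (((i0.const_mul _).add (i1.const_mul _)).add (i2.const_mul _)).add i3
    refine this.congr_fun (fun v _ => ?_) measurableSet_Ioo
    simp only
    ring
  · have : ∫ v in Ioo (0 : ℝ) 1, (l + Real.log v) ^ 3 / (1 + v) + (Real.log v - l) ^ 3 / (1 + v)
      = ∫ v in Ioo (0 : ℝ) 1, (2 * (Real.log v ^ (2 + 1) / (1 + v)) + 6 * l ^ 2 * (Real.log v ^ (0 + 1) / (1 + v))) := by
      refine setIntegral_congr_fun measurableSet_Ioo fun v _ => ?_
      ring
    rw [this, integral_add (i3.const_mul _) (i1.const_mul _), integral_const_mul, integral_const_mul, v1]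
    ring

lemma inv_piece {y : ℝ} (hy : y ∈ Ioo (0 : ℝ) 1) :
    (∫ v in (1 : ℝ)..(1 / y), (Real.log y + Real.log v) ^ 3 / (1 + v))
      - (∫ v in y..(1 : ℝ), (Real.log v - Real.log y) ^ 3 / (1 + v)) = - Real.log y ^ 4 / 4 := by
  have h0 := hy.1
  have h1 := hy.2
  have hpos : ∀ x ∈ uIcc y 1, 0 < x := by
    intro x hx
    rw [uIcc_of_le h1.le] at hx
    linarith [hx.1]
  have hcl : ContinuousOn (fun w : ℝ => Real.log w) (uIcc y 1) :=
    Real.continuousOn_log.mono fun x hx => (hpos x hx).ne'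
  have e1 : (∫ v in (1 : ℝ)..(1 / y), (Real.log y + Real.log v) ^ 3 / (1 + v))
      = ∫ w in y..(1 : ℝ), (Real.log y - Real.log w) ^ 3 / (w * (1 + w)) := by
    have hd : ∀ x ∈ uIcc y 1, HasDerivAt (fun w : ℝ => w⁻¹) (-(x ^ 2)⁻¹) x := fun x hx => hasDerivAt_inv (hpos x hx).ne'
    have := intervalIntegral.integral_comp_mul_deriv' (a := y) (b := 1) (f := fun w : ℝ => w⁻¹)
      (f' := fun x => -(x ^ 2)⁻¹) (g := fun v => (Real.log y + Real.log v) ^ 3 / (1 + v)) hd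
      (by
        refine ContinuousOn.neg (ContinuousOn.inv₀ (by fun_prop) fun x hx => ?_)
        have := hpos x hx
        positivity)
      (by
        have him : ∀ v ∈ (fun w : ℝ => w⁻¹) '' uIcc y 1, 0 < v := by
          rintro _ ⟨x, hx, rfl⟩
          exact inv_pos.2 (hpos x hx)
        refine ContinuousOn.div (ContinuousOn.pow (ContinuousOn.add continuousOn_const
          (Real.continuousOn_log.mono fun x hx => (him x hx).ne')) 3) (by fun_prop) fun x hx => ?_
        linarith [him x hx])
    rw [inv_one] at this
    rw [one_div, intervalIntegral.integral_symm, ← this, ← intervalIntegral.integral_neg]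
    refine intervalIntegral.integral_congr fun w hw => ?_
    have hw0 := hpos w hw
    simp only [Function.comp, Real.log_inv]
    field_simp
    ring
  rw [e1, ← intervalIntegral.integral_sub]
  · have e2 : ∫ w in y..(1 : ℝ), ((Real.log y - Real.log w) ^ 3 / (w * (1 + w)) - (Real.log w - Real.log y) ^ 3 / (1 + w))
        = ∫ w in y..(1 : ℝ), (Real.log y - Real.log w) ^ 3 / w := by
      refine intervalIntegral.integral_congr fun w hw => ?_
      have hw0 := hpos w hw
      field_simp
      ring
    rw [e2, intervalIntegral.integral_eq_sub_of_hasDerivAt (f := fun w => -(Real.log y - Real.log w) ^ 4 / 4)]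
    · simp
    · intro w hw
      have hw0 := hpos w hw
      have := ((((Real.hasDerivAt_log hw0.ne').const_sub (Real.log y)).pow 4).neg).div_const 4
      refine this.congr_deriv ?_
      norm_num
      field_simp
    · refine ContinuousOn.intervalIntegrable (ContinuousOn.div (by fun_prop) (by fun_prop) fun x hx => (hpos x hx).ne')
  · refine ContinuousOn.intervalIntegrable (ContinuousOn.div (by fun_prop) (by fun_prop) fun x hx => ?_)
    have := hpos x hx
    positivity
  · refine ContinuousOn.intervalIntegrable (ContinuousOn.div (by fun_prop) (by fun_prop) fun x hx => ?_)
    have := hpos x hx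
    positivity

lemma Ioo_to_interval {a b : ℝ} (hab : a ≤ b) (f : ℝ → ℝ) : ∫ x in Ioo a b, f x = ∫ x in a..b, f x := by
  rw [intervalIntegral.integral_of_le hab, integral_Ioc_eq_integral_Ioo]

lemma Ioo_intervalIntegrable {a b : ℝ} (hab : a ≤ b) {f : ℝ → ℝ} :
    IntervalIntegrable f volume a b ↔ IntegrableOn f (Ioo a b) := by
  rw [intervalIntegrable_iff_integrableOn_Ioo_of_le hab]

lemma Phi_val {y : ℝ} (hy : y ∈ Ioo (0 : ℝ) 1) :
    (∫ s in (0 : ℝ)..1, Real.log s ^ 3 / (s + y)) + (∫ s in (0 : ℝ)..1, y * Real.log s ^ 3 / (1 + y * s))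
      - 2 * (∫ v in (0 : ℝ)..1, Real.log v ^ 3 / (1 + v)) = - Real.log y ^ 4 / 4 - π ^ 2 / 2 * Real.log y ^ 2 := by
  have h0 := hy.1
  have h1 := hy.2
  obtain ⟨c1, c2, c3⟩ := cubic_integrable (Real.log y)
  rw [integral_add c1 c2] at c3
  simp only [Ioo_to_interval zero_le_one] at c3
  have i1 := (Ioo_intervalIntegrable zero_le_one).2 c1
  have i2 := (Ioo_intervalIntegrable zero_le_one).2 c2
  have h1y : 1 ≤ 1 / y := by rw [le_div_iff₀ h0]; linarith
  have i3 : IntervalIntegrable (fun v : ℝ => (Real.log y + Real.log v) ^ 3 / (1 + v)) volume 1 (1 / y) := by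
    have hp : ∀ x ∈ uIcc 1 (1 / y), 0 < x := by
      intro x hx
      rw [uIcc_of_le h1y] at hx
      linarith [hx.1]
    have : ContinuousOn (fun w : ℝ => Real.log w) (uIcc 1 (1 / y)) :=
      Real.continuousOn_log.mono fun x hx => (hp x hx).ne'
    refine ContinuousOn.intervalIntegrable (ContinuousOn.div (by fun_prop) (by fun_prop) fun x hx => ?_)
    linarith [hp x hx]
  have e1 : (∫ s in (0 : ℝ)..1, Real.log s ^ 3 / (s + y)) = ∫ v in (0 : ℝ)..(1 / y), (Real.log y + Real.log v) ^ 3 / (1 + v) := by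
    have := intervalIntegral.integral_comp_mul_left (a := 0) (b := 1 / y) (fun s => Real.log s ^ 3 / (s + y)) h0.ne'
    rw [mul_zero, mul_one_div_cancel h0.ne', smul_eq_mul, inv_mul_eq_div, eq_div_iff h0.ne'] at this
    rw [← this, ← intervalIntegral.integral_mul_const]
    refine intervalIntegral.integral_congr_ae (Eventually.of_forall fun v hv => ?_)
    rw [uIoc_of_le (by positivity)] at hv
    have hv0 := hv.1
    rw [Real.log_mul h0.ne' hv0.ne']
    field_simp
    ring
  have e2 : (∫ s in (0 : ℝ)..1, y * Real.log s ^ 3 / (1 + y * s)) = ∫ v in (0 : ℝ)..y, (Real.log v - Real.log y) ^ 3 / (1 + v) := by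
    have := intervalIntegral.integral_comp_mul_left (a := 0) (b := 1) (fun v => (Real.log v - Real.log y) ^ 3 / (1 + v)) h0.ne'
    rw [mul_zero, mul_one, smul_eq_mul, inv_mul_eq_div, eq_div_iff h0.ne'] at this
    rw [← this, ← intervalIntegral.integral_mul_const]
    refine intervalIntegral.integral_congr_ae (Eventually.of_forall fun v hv => ?_)
    rw [uIoc_of_le zero_le_one] at hv
    have hv0 := hv.1
    rw [Real.log_mul h0.ne' hv0.ne']
    ring
  have s1 := intervalIntegral.integral_add_adjacent_intervals i1 i3
  have sub1 : uIcc 0 y ⊆ uIcc (0 : ℝ) 1 := by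
    rw [uIcc_of_le h0.le, uIcc_of_le zero_le_one]; exact Icc_subset_Icc le_rfl h1.le
  have sub2 : uIcc y 1 ⊆ uIcc (0 : ℝ) 1 := by
    rw [uIcc_of_le h1.le, uIcc_of_le zero_le_one]; exact Icc_subset_Icc h0.le le_rfl
  have s2 := intervalIntegral.integral_add_adjacent_intervals (i2.mono_set sub1) (i2.mono_set sub2)
  have s3 := inv_piece hy
  rw [e1, e2]
  linear_combination (-1 : ℝ) * s1 + s2 + s3 + c3

lemma kappa_s {y : ℝ} (hy : y ∈ Ioo (0 : ℝ) 1) :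
    ∫ s in Ioo (0 : ℝ) 1, Real.log s ^ 3 * ((1 - s) * (1 - y) / ((1 + s) * (1 + y) * (s + y) * (1 + y * s)))
      = (- Real.log y ^ 4 / 4 - π ^ 2 / 2 * Real.log y ^ 2) / (1 - y ^ 2) := by
  have h0 := hy.1
  have h1 := hy.2
  have hl : IntegrableOn (fun s : ℝ => Real.log s ^ 3) (Ioo 0 1) := by
    have := (logpow_int 3 0).1
    simpa using this
  have key : ∀ q : ℝ → ℝ, ContinuousOn q (Icc 0 1) → IntegrableOn (fun s => Real.log s ^ 3 * q s) (Ioo 0 1) := by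
    intro q hq
    have h1 : IntegrableOn (fun s : ℝ => Real.log s ^ 3) (Icc 0 1) := by
      rwa [integrableOn_Icc_iff_integrableOn_Ioo]
    exact (h1.mul_continuousOn hq isCompact_Icc).mono_set Ioo_subset_Icc_self
  have a1 : IntegrableOn (fun s : ℝ => Real.log s ^ 3 / (s + y)) (Ioo 0 1) :=
    key (fun s => (s + y)⁻¹) (ContinuousOn.inv₀ (by fun_prop) fun s hs => by linarith [hs.1])
  have a2 : IntegrableOn (fun s : ℝ => y * Real.log s ^ 3 / (1 + y * s)) (Ioo 0 1) := by
    refine (key (fun s => y * (1 + y * s)⁻¹) (ContinuousOn.mul continuousOn_const (ContinuousOn.inv₀ (by fun_prop) fun s hs => ?_))).congr_fun (fun s _ => ?_) measurableSet_Ioo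
    · have := hs.1
      positivity
    · simp only; ring
  have a3 : IntegrableOn (fun s : ℝ => Real.log s ^ 3 / (1 + s)) (Ioo 0 1) :=
    key (fun s => (1 + s)⁻¹) (ContinuousOn.inv₀ (by fun_prop) fun s hs => by linarith [hs.1])
  have e : ∫ s in Ioo (0 : ℝ) 1, Real.log s ^ 3 * ((1 - s) * (1 - y) / ((1 + s) * (1 + y) * (s + y) * (1 + y * s)))
      = ∫ s in Ioo (0 : ℝ) 1, (Real.log s ^ 3 / (s + y) + y * Real.log s ^ 3 / (1 + y * s) - 2 * (Real.log s ^ 3 / (1 + s))) / (1 - y ^ 2) := by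
    refine setIntegral_congr_fun measurableSet_Ioo fun s hs => ?_
    have hs0 := hs.1
    have p4 : 1 - y ≠ 0 := by linarith
    have p5 : 1 + y ≠ 0 := by linarith
    have p6 : s + y ≠ 0 := by positivity
    have p7 : 1 + y * s ≠ 0 := by positivity
    have p8 : 1 + s ≠ 0 := by positivity
    rw [show 1 - y ^ 2 = (1 - y) * (1 + y) by ring]
    field_simp
    ring
  rw [e, integral_div, ← Phi_val hy]
  congr 1
  have a4 : IntegrableOn (fun s : ℝ => Real.log s ^ 3 / (s + y) + y * Real.log s ^ 3 / (1 + y * s)) (Ioo 0 1) := a1.add a2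
  rw [integral_sub a4 (a3.const_mul 2), integral_add a1 a2, integral_const_mul]
  simp only [Ioo_to_interval zero_le_one]

lemma K_val : ∫ s in Ioo (0 : ℝ) 1, Real.log s ^ 3 * ((2 * Real.log (1 + s) - 2 * Real.log 2 - Real.log s) / (1 - s ^ 2))
    = - 93 / 16 * zetaVal 5 - 21 / 4 * zetaVal 2 * zetaVal 3 := by
  have e1 : ∫ s in Ioo (0 : ℝ) 1, Real.log s ^ 3 * ((2 * Real.log (1 + s) - 2 * Real.log 2 - Real.log s) / (1 - s ^ 2))
      = ∫ s in Ioo (0 : ℝ) 1, ∫ y in Ioo (0 : ℝ) 1, Real.log s ^ 3 * ((1 - s) * (1 - y) / ((1 + s) * (1 + y) * (s + y) * (1 + y * s))) := by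
    refine setIntegral_congr_fun measurableSet_Ioo fun s hs => ?_
    rw [integral_const_mul, (kappa_y hs).2]
  rw [e1, integral_integral_swap]
  · rw [setIntegral_congr_fun measurableSet_Ioo fun y hy => kappa_s hy]
    have b4 := log_sq_int 3
    have b2 := log_sq_int 1
    have e2 : ∫ y in Ioo (0 : ℝ) 1, (- Real.log y ^ 4 / 4 - π ^ 2 / 2 * Real.log y ^ 2) / (1 - y ^ 2)
        = ∫ y in Ioo (0 : ℝ) 1, ((-1 / 4) * (Real.log y ^ (3 + 1) / (1 - y ^ 2)) + (- π ^ 2 / 2) * (Real.log y ^ (1 + 1) / (1 - y ^ 2))) := by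
      refine setIntegral_congr_fun measurableSet_Ioo fun y _ => ?_
      ring
    rw [e2, integral_add (b4.1.const_mul _) (b2.1.const_mul _), integral_const_mul, integral_const_mul, b4.2, b2.2, zeta2_val]
    norm_num [Nat.factorial]
    ring
  · rw [integrable_prod_iff]
    · constructor
      · refine (ae_restrict_iff' measurableSet_Ioo).2 (Eventually.of_forall fun s hs => ?_)
        have hk := (kappa_y hs).1.const_mul (Real.log s ^ 3)
        simpa only [Function.uncurry] using hk
      · have := Lam_integrable.norm
        refine (integrable_congr ?_).1 this
        refine (ae_restrict_iff' measurableSet_Ioo).2 (Eventually.of_forall fun s hs => ?_)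
        have hb := Lam_bound hs
        have h2 : 0 ≤ 1 - s ^ 2 := by nlinarith [hs.1, hs.2]
        simp only [Function.uncurry, norm_mul]
        rw [integral_const_mul, Real.norm_of_nonneg (div_nonneg hb.1 h2), ← (kappa_y hs).2]
        congr 1
        refine setIntegral_congr_fun measurableSet_Ioo fun y hy => ?_
        have := hs.1
        have := hy.1
        have h3 : 0 ≤ 1 - s := by linarith [hs.2]
        have h4 : 0 ≤ 1 - y := by linarith [hy.2]
        exact (Real.norm_of_nonneg (by positivity)).symm
    · exact (by unfold Function.uncurry; fun_prop : Measurable _).aestronglyMeasurable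

lemma J_val : IntegrableOn (fun t : ℝ => ((Real.log (1 + t) - Real.log (1 - t)) ^ 3 * (Real.log (1 + t) + Real.log (1 - t))) / t) (Ioo 0 1) ∧
    ∫ t in Ioo (0 : ℝ) 1, ((Real.log (1 + t) - Real.log (1 - t)) ^ 3 * (Real.log (1 + t) + Real.log (1 - t))) / t
      = - 93 / 8 * zetaVal 5 - 21 / 2 * zetaVal 2 * zetaVal 3 := by
  have h := cv_mobius (fun t => (Real.log (1 + t) - Real.log (1 - t)) ^ 3 * (Real.log (1 + t) + Real.log (1 - t)))
    (fun s => 2 * (Real.log s ^ 3 * ((2 * Real.log (1 + s) - 2 * Real.log 2 - Real.log s) / (1 - s ^ 2)))) (by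
      intro s hs
      have h1 : 0 < 1 + s := by linarith [hs.1]
      have e1 : 1 + (1 - s) / (1 + s) = 2 / (1 + s) := by field_simp; ring
      have e2 : 1 - (1 - s) / (1 + s) = 2 * s / (1 + s) := by field_simp; ring
      simp only [e1, e2]
      rw [Real.log_div (by norm_num) h1.ne', Real.log_div (by nlinarith [hs.1]) h1.ne', Real.log_mul (by norm_num) hs.1.ne']
      ring)
  refine ⟨h.1.2 (Lam_integrable.const_mul _), ?_⟩
  rw [h.2, integral_const_mul, K_val]
  ring

lemma quartic_int (c : ℝ) : IntegrableOn (fun s : ℝ => ((Real.log s + c) ^ 4 - c ^ 4) / (1 - s)) (Ioo 0 1) ∧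
    ∫ s in Ioo (0 : ℝ) 1, ((Real.log s + c) ^ 4 - c ^ 4) / (1 - s)
      = 24 * zetaVal 5 - 24 * c * zetaVal 4 + 12 * c ^ 2 * zetaVal 3 - 4 * c ^ 3 * zetaVal 2 := by
  have hp : ∀ k : ℕ, IntegrableOn (fun v : ℝ => Real.log v ^ (k + 1) / (1 - v)) (Ioo 0 1) ∧
      ∫ v in Ioo (0 : ℝ) 1, Real.log v ^ (k + 1) / (1 - v) = (-1) ^ (k + 1) * ((k + 1).factorial : ℝ) * zetaVal (k + 2) := by
    intro k
    have := polylog_int k 1 (by simp)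
    rw [zeta_tsum] at this
    simpa only [one_mul] using this
  have h0 := hp 0
  have h1 := hp 1
  have h2 := hp 2
  have h3 := hp 3
  have e : EqOn (fun s : ℝ => Real.log s ^ (3 + 1) / (1 - s) + (4 * c) * (Real.log s ^ (2 + 1) / (1 - s))
      + (6 * c ^ 2) * (Real.log s ^ (1 + 1) / (1 - s)) + (4 * c ^ 3) * (Real.log s ^ (0 + 1) / (1 - s)))
      (fun s : ℝ => ((Real.log s + c) ^ 4 - c ^ 4) / (1 - s)) (Ioo 0 1) := by
    intro s _
    simp only
    ring
  have i1 := h3.1.add (h2.1.const_mul (4 * c))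
  have i2 := i1.add (h1.1.const_mul (6 * c ^ 2))
  have i3 := i2.add (h0.1.const_mul (4 * c ^ 3))
  refine ⟨IntegrableOn.congr_fun i3 e measurableSet_Ioo, ?_⟩
  rw [← setIntegral_congr_fun measurableSet_Ioo e]
  rw [integral_add (by exact i2) (h0.1.const_mul (4 * c ^ 3)), integral_add (by exact i1) (h1.1.const_mul (6 * c ^ 2)),
    integral_add h3.1 (h2.1.const_mul (4 * c)), integral_const_mul, integral_const_mul, integral_const_mul,
    h0.2, h1.2, h2.2, h3.2]
  norm_num [Nat.factorial]
  ring

lemma Sa_val : IntegrableOn (fun t : ℝ => ((Real.log (1 - t) - Real.log 2) ^ 4 - Real.log 2 ^ 4) / t) (Ioo 0 1) ∧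
    ∫ t in Ioo (0 : ℝ) 1, ((Real.log (1 - t) - Real.log 2) ^ 4 - Real.log 2 ^ 4) / t
      = 24 * zetaVal 5 + 24 * Real.log 2 * zetaVal 4 + 12 * Real.log 2 ^ 2 * zetaVal 3 + 4 * Real.log 2 ^ 3 * zetaVal 2 := by
  have h := quartic_int (- Real.log 2)
  have hi := ((Ioo_intervalIntegrable zero_le_one).2 h.1).comp_sub_left 1
  have hv := intervalIntegral.integral_comp_sub_left (a := 0) (b := 1) (fun s : ℝ => ((Real.log s + (- Real.log 2)) ^ 4 - (- Real.log 2) ^ 4) / (1 - s)) 1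
  have e : ∀ t : ℝ, ((Real.log (1 - t) + (- Real.log 2)) ^ 4 - (- Real.log 2) ^ 4) / (1 - (1 - t)) = ((Real.log (1 - t) - Real.log 2) ^ 4 - Real.log 2 ^ 4) / t := by
    intro t
    rw [sub_sub_cancel]
    ring
  simp only [e, sub_zero, sub_self] at hi hv
  refine ⟨(Ioo_intervalIntegrable zero_le_one).1 hi.symm, ?_⟩
  rw [Ioo_to_interval zero_le_one, hv, ← Ioo_to_interval zero_le_one, h.2]
  ring

lemma Li5_piece : ∫ w in (0:ℝ)..(1 / 2), ((Real.log w + Real.log 2) ^ 4 - Real.log 2 ^ 4) / (1 - w)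
    = 24 * polyLog 5 (1 / 2) - Real.log 2 ^ 5 := by
  have h := polylog_int 3 (1 / 2) (by norm_num [abs_le])
  have hsc := intervalIntegral.integral_comp_mul_left (a := 0) (b := 1) (fun w : ℝ => ((Real.log w + Real.log 2) ^ 4 - Real.log 2 ^ 4) / (1 - w)) (c := 1 / 2) (by norm_num)
  rw [mul_zero, mul_one, smul_eq_mul] at hsc
  have h2 : ∫ x in (0:ℝ)..1, 1 / (1 - 1 / 2 * x) = 2 * Real.log 2 := by
    rw [intervalIntegral.integral_eq_sub_of_hasDerivAt (f := fun x => -2 * Real.log (1 - 1 / 2 * x))]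
    · norm_num
      rw [show (1 / 2 : ℝ) = 2⁻¹ by norm_num, Real.log_inv]
      ring
    · intro x hx
      rw [uIcc_of_le zero_le_one] at hx
      have hx1 : (1 - 1 / 2 * x) ≠ 0 := by linarith [hx.2]
      have := ((((hasDerivAt_id x).const_mul (1 / 2 : ℝ)).const_sub 1).log hx1).const_mul (-2)
      refine this.congr_deriv ?_
      simp only [id]
      field_simp
    · refine ContinuousOn.intervalIntegrable (ContinuousOn.div (by fun_prop) (by fun_prop) fun x hx => ?_)
      rw [uIcc_of_le zero_le_one] at hx
      linarith [hx.2]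
  have i2 : IntervalIntegrable (fun x : ℝ => 1 / (1 - 1 / 2 * x)) volume 0 1 := by
    refine ContinuousOn.intervalIntegrable (ContinuousOn.div (by fun_prop) (by fun_prop) fun x hx => ?_)
    rw [uIcc_of_le zero_le_one] at hx
    linarith [hx.2]
  have e : ∫ x in (0:ℝ)..1, ((Real.log (1 / 2 * x) + Real.log 2) ^ 4 - Real.log 2 ^ 4) / (1 - 1 / 2 * x)
      = ∫ x in (0:ℝ)..1, (Real.log x ^ (3 + 1) / (1 - 1 / 2 * x) - Real.log 2 ^ 4 * (1 / (1 - 1 / 2 * x))) := by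
    refine intervalIntegral.integral_congr_ae (Eventually.of_forall fun x hx => ?_)
    rw [uIoc_of_le zero_le_one] at hx
    rw [Real.log_mul (by norm_num) hx.1.ne', one_div, Real.log_inv]
    ring
  rw [e, intervalIntegral.integral_sub ((Ioo_intervalIntegrable zero_le_one).2 h.1) (i2.const_mul _),
    intervalIntegral.integral_const_mul, h2, ← Ioo_to_interval zero_le_one, h.2] at hsc
  have hp : polyLog 5 (1 / 2) = 1 / 2 * ∑' n : ℕ, (1 / 2 : ℝ) ^ n / ((n : ℝ) + 1) ^ (3 + 2) := by
    rw [polyLog, ← tsum_mul_left]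
    refine tsum_congr fun n => ?_
    rw [pow_succ]
    ring
  rw [hp]
  have : ((3 + 1).factorial : ℝ) = 24 := by norm_num [Nat.factorial]
  rw [this] at hsc
  norm_num at hsc ⊢
  linarith

lemma Sb_val : IntegrableOn (fun t : ℝ => ((Real.log (1 + t) - Real.log 2) ^ 4 - Real.log 2 ^ 4) / t) (Ioo 0 1) ∧
    ∫ t in Ioo (0 : ℝ) 1, ((Real.log (1 + t) - Real.log 2) ^ 4 - Real.log 2 ^ 4) / t
      = 24 * zetaVal 5 - 24 * Real.log 2 * zetaVal 4 + 12 * Real.log 2 ^ 2 * zetaVal 3 - 4 * Real.log 2 ^ 3 * zetaVal 2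
        - 24 * polyLog 5 (1 / 2) + Real.log 2 ^ 5 / 5 := by
  have h := quartic_int (Real.log 2)
  have hI := (Ioo_intervalIntegrable zero_le_one).2 h.1
  have hh : (1 / 2 : ℝ) ≤ 1 := by norm_num
  have hi2 : IntervalIntegrable (fun s : ℝ => ((Real.log s + Real.log 2) ^ 4 - Real.log 2 ^ 4) / (1 - s)) volume (1 / 2) 1 :=
    hI.mono_set (by rw [uIcc_of_le hh, uIcc_of_le zero_le_one]; exact Icc_subset_Icc (by norm_num) le_rfl)
  have hi1 : IntervalIntegrable (fun s : ℝ => ((Real.log s + Real.log 2) ^ 4 - Real.log 2 ^ 4) / (1 - s)) volume 0 (1 / 2) :=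
    hI.mono_set (by rw [uIcc_of_le (by norm_num : (0:ℝ) ≤ 1 / 2), uIcc_of_le zero_le_one]; exact Icc_subset_Icc le_rfl hh)
  have hadd := intervalIntegral.integral_add_adjacent_intervals hi1 hi2
  rw [Li5_piece, ← Ioo_to_interval zero_le_one, h.2] at hadd
  have hpos : ∀ x ∈ uIcc (1 / 2 : ℝ) 1, 0 < x := by
    intro x hx
    rw [uIcc_of_le hh] at hx
    linarith [hx.1]
  have hcl : ContinuousOn (fun w : ℝ => Real.log w) (uIcc (1 / 2) 1) :=
    Real.continuousOn_log.mono fun x hx => (hpos x hx).ne'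
  have hi3 : IntervalIntegrable (fun s : ℝ => ((Real.log s + Real.log 2) ^ 4 - Real.log 2 ^ 4) / s) volume (1 / 2) 1 := by
    refine ContinuousOn.intervalIntegrable (ContinuousOn.div (by fun_prop) (by fun_prop) fun x hx => (hpos x hx).ne')
  have hv3 : ∫ s in (1 / 2 : ℝ)..1, ((Real.log s + Real.log 2) ^ 4 - Real.log 2 ^ 4) / s = Real.log 2 ^ 5 / 5 - Real.log 2 ^ 5 := by
    rw [intervalIntegral.integral_eq_sub_of_hasDerivAt (f := fun x => (Real.log x + Real.log 2) ^ 5 / 5 - Real.log 2 ^ 4 * Real.log x)]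
    · rw [one_div, Real.log_inv]
      simp
      ring
    · intro x hx
      have hx0 := (hpos x hx).ne'
      have := ((((Real.hasDerivAt_log hx0).add_const (Real.log 2)).pow 5).div_const 5).sub ((Real.hasDerivAt_log hx0).const_mul (Real.log 2 ^ 4))
      refine this.congr_deriv ?_
      norm_num
      field_simp
    · exact hi3
  have hd : ∀ w ∈ Ioo (1 / 2 : ℝ) 1, HasDerivWithinAt (fun w : ℝ => w⁻¹ - 1) (-(w ^ 2)⁻¹) (Ioo (1 / 2) 1) w := by
    intro w hw
    exact ((hasDerivAt_inv (by linarith [hw.1])).sub_const 1).hasDerivWithinAt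
  have hinj : InjOn (fun w : ℝ => w⁻¹ - 1) (Ioo (1 / 2) 1) := by
    intro a _ b _ hab
    simpa using hab
  have him : (fun w : ℝ => w⁻¹ - 1) '' Ioo (1 / 2) 1 = Ioo 0 1 := by
    ext t
    simp only [mem_image, mem_Ioo]
    constructor
    · rintro ⟨w, ⟨h1, h2⟩, rfl⟩
      have hw : 0 < w := by linarith
      constructor
      · have := (one_lt_inv₀ hw).2 h2
        linarith
      · have := inv_strictAnti₀ (by norm_num) h1
        norm_num at this
        linarith
    · rintro ⟨h1, h2⟩
      refine ⟨(1 + t)⁻¹, ⟨?_, ?_⟩, by simp⟩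
      · rw [one_div]
        exact inv_strictAnti₀ (by linarith) (by linarith)
      · exact inv_lt_one_of_one_lt₀ (by linarith)
  have e : EqOn (fun w : ℝ => |(-(w ^ 2)⁻¹ : ℝ)| • (((Real.log (1 + (w⁻¹ - 1)) - Real.log 2) ^ 4 - Real.log 2 ^ 4) / (w⁻¹ - 1)))
      (fun w => ((Real.log w + Real.log 2) ^ 4 - Real.log 2 ^ 4) / w + ((Real.log w + Real.log 2) ^ 4 - Real.log 2 ^ 4) / (1 - w)) (Ioo (1 / 2) 1) := by
    intro w hw
    have hw0 : 0 < w := by linarith [hw.1]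
    have hw1 : 1 - w ≠ 0 := by linarith [hw.2]
    simp only
    rw [abs_neg, abs_of_pos (by positivity), add_sub_cancel, Real.log_inv, smul_eq_mul,
      show w⁻¹ - 1 = (1 - w) / w by field_simp]
    field_simp
    ring
  have hi4 := hi3.add hi2
  constructor
  · rw [← him, integrableOn_image_iff_integrableOn_abs_deriv_smul measurableSet_Ioo hd hinj]
    exact ((Ioo_intervalIntegrable hh).1 hi4).congr_fun e.symm measurableSet_Ioo
  · rw [← him, integral_image_eq_integral_abs_deriv_smul measurableSet_Ioo hd hinj, setIntegral_congr_fun measurableSet_Ioo e,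
      Ioo_to_interval hh, intervalIntegral.integral_add hi3 hi2, hv3]
    linarith

/-- The real boundary function. -/
noncomputable def FF (t : ℝ) : ℝ :=
  (Real.log (1 + t) - Real.log 2) ^ 3 * (Real.log (1 - t) - Real.log 2) - (Real.log (1 + t) - Real.log 2) ^ 4 / 4

lemma FF_val : IntegrableOn (fun t : ℝ => (FF t - FF (-t)) / t) (Ioo 0 1) ∧
    ∫ t in Ioo (0 : ℝ) 1, (FF t - FF (-t)) / t
      = -1 / 2 * ((- 93 / 8 * zetaVal 5 - 21 / 2 * zetaVal 2 * zetaVal 3) - 2 * Real.log 2 * (45 / 4 * zetaVal 4))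
        + 1 / 4 * (-48 * Real.log 2 * zetaVal 4 - 8 * Real.log 2 ^ 3 * zetaVal 2 - 24 * polyLog 5 (1 / 2) + Real.log 2 ^ 5 / 5) := by
  have a := Sa_val
  have b := Sb_val
  have j := J_val
  have k := J3_val
  have i1 := j.1.const_mul (-1 / 2)
  have i2 := k.1.const_mul (Real.log 2)
  have i3 := b.1.const_mul (1 / 4)
  have i4 := a.1.const_mul (-1 / 4)
  have i12 := i1.add i2
  have i123 := i12.add i3
  have i1234 := i123.add i4
  have e : EqOn (fun t => -1 / 2 * (((Real.log (1 + t) - Real.log (1 - t)) ^ 3 * (Real.log (1 + t) + Real.log (1 - t))) / t)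
      + Real.log 2 * ((Real.log (1 + t) - Real.log (1 - t)) ^ 3 / t)
      + 1 / 4 * (((Real.log (1 + t) - Real.log 2) ^ 4 - Real.log 2 ^ 4) / t)
      + -1 / 4 * (((Real.log (1 - t) - Real.log 2) ^ 4 - Real.log 2 ^ 4) / t)) (fun t : ℝ => (FF t - FF (-t)) / t) (Ioo 0 1) := by
    intro t _
    simp only [FF, sub_neg_eq_add, ← sub_eq_add_neg]
    ring
  refine ⟨IntegrableOn.congr_fun i1234 e measurableSet_Ioo, ?_⟩
  rw [← setIntegral_congr_fun measurableSet_Ioo e]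
  rw [integral_add (by exact i123) i4, integral_add (by exact i12) i3, integral_add i1 i2, integral_const_mul, integral_const_mul,
    integral_const_mul, integral_const_mul, a.2, b.2, j.2, k.2]
  ring

/-- Shifted complex logarithm of `1 + z`. -/
noncomputable def UU (z : ℂ) : ℂ := Complex.log (1 + z) - ((Real.log 2 : ℝ) : ℂ)

/-- The analytic function whose boundary values are integrated. -/
noncomputable def HH (z : ℂ) : ℂ :=
  UU z ^ 3 * UU (-z) - UU z ^ 4 / 4 + Complex.I * ((π / 2 : ℝ) : ℂ) * UU z ^ 3

lemma UU_diff {z : ℂ} (hz : ‖z‖ < 1) : DifferentiableAt ℂ UU z := by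
  unfold UU
  have := Complex.mem_slitPlane_of_norm_lt_one hz
  exact ((differentiableAt_const _).add differentiableAt_id).clog this |>.sub (differentiableAt_const _)

lemma UU_neg_diff {z : ℂ} (hz : ‖z‖ < 1) : DifferentiableAt ℂ (fun z => UU (-z)) z := by
  have h : DifferentiableAt ℂ UU (-z) := UU_diff (by simpa using hz)
  exact h.comp z differentiableAt_id.neg

lemma HH_diff {z : ℂ} (hz : ‖z‖ < 1) : DifferentiableAt ℂ HH z := by
  unfold HH
  have h1 := UU_diff hz
  have h2 := UU_neg_diff hz
  fun_prop

lemma UU_real {t : ℝ} (ht : -1 < t) : UU (t : ℂ) = ((Real.log (1 + t) - Real.log 2 : ℝ) : ℂ) := by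
  unfold UU
  rw [Complex.ofReal_sub, Complex.ofReal_log (show (0 : ℝ) ≤ 1 + t by linarith), Complex.ofReal_add, Complex.ofReal_one]

lemma HH_real {t : ℝ} (h1 : -1 < t) (h2 : t < 1) : (HH (t : ℂ)).re = FF t := by
  unfold HH FF
  have e : UU (-(t : ℂ)) = ((Real.log (1 - t) - Real.log 2 : ℝ) : ℂ) := by
    have := UU_real (t := -t) (by linarith)
    rw [Complex.ofReal_neg] at this
    rw [this, sub_eq_add_neg 1 t]
  rw [UU_real h1, e]
  generalize Real.log (1 + t) - Real.log 2 = p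
  generalize Real.log (1 - t) - Real.log 2 = q
  have : ((p : ℂ) ^ 3 * (q : ℂ) - (p : ℂ) ^ 4 / 4 + Complex.I * ((π / 2 : ℝ) : ℂ) * (p : ℂ) ^ 3)
      = ((p ^ 3 * q - p ^ 4 / 4 : ℝ) : ℂ) + ((π / 2 * p ^ 3 : ℝ) : ℂ) * Complex.I := by
    push_cast; ring
  rw [this, Complex.add_re, Complex.ofReal_re, Complex.re_ofReal_mul, Complex.I_re]
  ring

lemma HH_zero_im : (HH 0).im = - (π / 2) * Real.log 2 ^ 3 := by
  have h : UU 0 = ((- Real.log 2 : ℝ) : ℂ) := by simp [UU]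
  unfold HH
  rw [neg_zero, h]
  have : (((- Real.log 2 : ℝ) : ℂ) ^ 3 * ((- Real.log 2 : ℝ) : ℂ) - ((- Real.log 2 : ℝ) : ℂ) ^ 4 / 4
      + Complex.I * ((π / 2 : ℝ) : ℂ) * ((- Real.log 2 : ℝ) : ℂ) ^ 3)
      = ((3 / 4 * Real.log 2 ^ 4 : ℝ) : ℂ) + ((- (π / 2) * Real.log 2 ^ 3 : ℝ) : ℂ) * Complex.I := by
    push_cast; ring
  rw [this, Complex.add_im, Complex.ofReal_im, Complex.im_ofReal_mul, Complex.I_im]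
  ring

/-- The circle parametrisation. -/
noncomputable def zz (ρ x : ℝ) : ℂ := (ρ : ℂ) * Complex.exp (((2 * x : ℝ) : ℂ) * Complex.I)

lemma zz_norm {ρ : ℝ} (h : 0 ≤ ρ) (x : ℝ) : ‖zz ρ x‖ = ρ := by
  rw [zz, norm_mul, Complex.norm_exp_ofReal_mul_I, mul_one, Complex.norm_of_nonneg h]

lemma zz_deriv (ρ x : ℝ) : HasDerivAt (zz ρ) (2 * Complex.I * zz ρ x) x := by
  have h1 : HasDerivAt (fun x : ℝ => ((2 * x : ℝ) : ℂ)) 2 x := by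
    have := ((hasDerivAt_id x).const_mul (2 : ℝ)).ofReal_comp
    simpa using this
  have := ((h1.mul_const Complex.I).cexp).const_mul (ρ : ℂ)
  refine this.congr_deriv ?_
  unfold zz
  ring

lemma zz_cont (ρ : ℝ) : Continuous (zz ρ) := by
  unfold zz
  fun_prop

lemma re_deriv {f : ℝ → ℂ} {f' : ℂ} {x : ℝ} (h : HasDerivAt f f' x) : HasDerivAt (fun y => (f y).re) f'.re x := by
  have := Complex.reCLM.hasFDerivAt.comp_hasDerivAt x h
  exact this

lemma contour {ρ : ℝ} (h0 : 0 < ρ) (h1 : ρ < 1) :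
    ∫ x in (0 : ℝ)..(π / 2), (HH (zz ρ x)).im
      = - (π ^ 2 / 4) * Real.log 2 ^ 3 + 1 / 2 * ∫ r in (0 : ℝ)..ρ, (FF r - FF (-r)) / r := by
  have hball : Metric.ball (0 : ℂ) 1 ∈ 𝓝 (0 : ℂ) := Metric.ball_mem_nhds _ one_pos
  have hd : DifferentiableOn ℂ HH (Metric.ball 0 1) := fun z hz =>
    (HH_diff (by simpa using hz)).differentiableWithinAt
  have hd2 := (Complex.differentiableOn_dslope hball).2 hd
  obtain ⟨G, hG⟩ := hd2.isExactOn_ball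
  have hGz : ∀ z : ℂ, ‖z‖ < 1 → HasDerivAt G (dslope HH 0 z) z := fun z hz => hG z (by simpa using hz)
  have hds : ∀ z : ℂ, z ≠ 0 → dslope HH 0 z = (HH z - HH 0) / z := by
    intro z hz
    rw [dslope_of_ne _ hz, slope_def_field, sub_zero]
  have nz : ∀ x, zz ρ x ≠ 0 := by
    intro x hx
    have := zz_norm h0.le x
    rw [hx, norm_zero] at this
    linarith
  -- angular part
  have A : ∫ x in (0 : ℝ)..(π / 2), ((HH (zz ρ x)).im - (HH 0).im)
      = -1 / 2 * (G (zz ρ (π / 2))).re - -1 / 2 * (G (zz ρ 0)).re := by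
    refine intervalIntegral.integral_eq_sub_of_hasDerivAt (f := fun x => -1 / 2 * (G (zz ρ x)).re) (fun x _ => ?_) ?_
    · have hn : ‖zz ρ x‖ < 1 := by rw [zz_norm h0.le]; exact h1
      have := (re_deriv ((hGz _ hn).comp x (zz_deriv ρ x))).const_mul (-1 / 2)
      refine this.congr_deriv ?_
      rw [hds _ (nz x)]
      have : (HH (zz ρ x) - HH 0) / zz ρ x * (2 * Complex.I * zz ρ x) = (2 : ℝ) * ((HH (zz ρ x) - HH 0) * Complex.I) := by
        have := nz x
        push_cast
        field_simp
      rw [this, Complex.re_ofReal_mul, Complex.mul_I_re, Complex.sub_im]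
      ring
    · apply Continuous.intervalIntegrable
      refine (Complex.continuous_im.comp ?_).sub continuous_const
      refine continuous_iff_continuousAt.2 fun x => ?_
      have hn : ‖zz ρ x‖ < 1 := by rw [zz_norm h0.le]; exact h1
      exact ContinuousAt.comp (HH_diff hn).continuousAt (zz_cont ρ).continuousAt
  have hI : IntervalIntegrable (fun x => (HH (zz ρ x)).im) volume 0 (π / 2) := by
    apply Continuous.intervalIntegrable
    refine Complex.continuous_im.comp ?_
    refine continuous_iff_continuousAt.2 fun x => ?_
    have hn : ‖zz ρ x‖ < 1 := by rw [zz_norm h0.le]; exact h1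
    exact ContinuousAt.comp (HH_diff hn).continuousAt (zz_cont ρ).continuousAt
  rw [intervalIntegral.integral_sub hI (by simp), intervalIntegral.integral_const, HH_zero_im] at A
  -- radial part
  have hdr : ∀ r ∈ Icc 0 ρ, HasDerivAt (fun r : ℝ => (G (r : ℂ)).re - (G (((-r : ℝ)) : ℂ)).re)
      ((dslope HH 0 (r : ℂ)).re + (dslope HH 0 ((-r : ℝ) : ℂ)).re) r := by
    intro r hr
    have hn : ‖(r : ℂ)‖ < 1 := by
      rw [Complex.norm_of_nonneg hr.1]; linarith [hr.2]
    have hn' : ‖((-r : ℝ) : ℂ)‖ < 1 := by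
      rw [Complex.ofReal_neg, norm_neg]; exact hn
    have d1 := re_deriv ((hGz _ hn).comp r (hasDerivAt_id r).ofReal_comp)
    have d2 := re_deriv ((hGz _ hn').comp r (hasDerivAt_id r).neg.ofReal_comp)
    refine (d1.sub d2).congr_deriv ?_
    simp
  have B : ∫ r in (0 : ℝ)..ρ, (FF r - FF (-r)) / r
      = ((G (ρ : ℂ)).re - (G ((-ρ : ℝ) : ℂ)).re) - ((G ((0 : ℝ) : ℂ)).re - (G ((-0 : ℝ) : ℂ)).re) := by
    refine intervalIntegral.integral_eq_sub_of_hasDerivAt_of_le h0.le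
      (f := fun r : ℝ => (G (r : ℂ)).re - (G (((-r : ℝ)) : ℂ)).re) (fun r hr => (hdr r hr).continuousAt.continuousWithinAt) (fun r hr => ?_) ?_
    · refine (hdr r ⟨hr.1.le, hr.2.le⟩).congr_deriv ?_
      have hr0 := hr.1.ne'
      have hr1 := hr.2
      rw [hds _ (by exact_mod_cast hr0), hds _ (by simpa using hr0), Complex.div_ofReal_re, Complex.div_ofReal_re,
        Complex.sub_re, Complex.sub_re, HH_real (by linarith [hr.1]) (by linarith), HH_real (by linarith [hr.1]) (by linarith [hr.1])]
      field_simp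
      ring
    · rw [Ioo_intervalIntegrable h0.le]
      exact FF_val.1.mono_set (Ioo_subset_Ioo le_rfl h1.le)
  have e0 : zz ρ 0 = (ρ : ℂ) := by simp [zz]
  have e1 : zz ρ (π / 2) = ((-ρ : ℝ) : ℂ) := by
    rw [zz, mul_div_cancel₀ _ two_ne_zero, Complex.exp_pi_mul_I]
    simp
  rw [e0, e1] at A
  rw [B]
  simp only [neg_zero, smul_eq_mul] at A ⊢
  linarith

lemma hs_congr {f g : ℕ → ℝ} {a b : ℝ} (h : HasSum f a) (h1 : ∀ n, g n = f n) (h2 : b = a) : HasSum g b := by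
  rw [h2, funext h1]
  exact h

lemma cn_val (n : ℕ) : ∫ x in (0 : ℝ)..(π / 2), x ^ 3 * Real.cos (2 * ((n : ℝ) + 1) * x)
    = - (3 * π ^ 2 / 16) * (-1) ^ n / ((n : ℝ) + 1) ^ 2 + 3 / 8 * (1 + (-1) ^ n) / ((n : ℝ) + 1) ^ 4 := by
  have hn : (n : ℝ) + 1 ≠ 0 := by positivity
  obtain ⟨m, hm⟩ : ∃ m : ℝ, m = 2 * ((n : ℝ) + 1) := ⟨_, rfl⟩
  have hm0 : m ≠ 0 := by rw [hm]; positivity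
  rw [← hm, intervalIntegral.integral_eq_sub_of_hasDerivAt
    (f := fun x => x ^ 3 * Real.sin (m * x) / m + 3 * x ^ 2 * Real.cos (m * x) / m ^ 2
      - 6 * x * Real.sin (m * x) / m ^ 3 - 6 * Real.cos (m * x) / m ^ 4)]
  · have h1 : m * (π / 2) = ((n + 1 : ℕ) : ℝ) * π := by rw [hm]; push_cast; ring
    simp only [h1, Real.sin_nat_mul_pi, Real.cos_nat_mul_pi]
    simp only [mul_zero, Real.sin_zero, Real.cos_zero, pow_succ (-1 : ℝ) n]
    rw [hm]
    field_simp
    ring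
  · intro x _
    have hs : HasDerivAt (fun x => Real.sin (m * x)) (Real.cos (m * x) * m) x := by
      have := ((hasDerivAt_id x).const_mul m).sin
      simpa using this
    have hc : HasDerivAt (fun x => Real.cos (m * x)) (-Real.sin (m * x) * m) x := by
      have := ((hasDerivAt_id x).const_mul m).cos
      simpa using this
    have d1 := ((hasDerivAt_pow 3 x).mul hs).div_const m
    have d2 := (((hasDerivAt_pow 2 x).const_mul 3).mul hc).div_const (m ^ 2)
    have d3 := (((hasDerivAt_id x).const_mul 6).mul hs).div_const (m ^ 3)
    have d4 := (hc.const_mul 6).div_const (m ^ 4)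
    refine (((d1.add d2).sub d3).sub d4).congr_deriv ?_
    simp only [id]
    norm_num
    field_simp
    ring
  · apply Continuous.intervalIntegrable
    fun_prop

lemma zz_pow_re (ρ x : ℝ) (n : ℕ) : (zz ρ x ^ n).re = ρ ^ n * Real.cos (2 * n * x) := by
  rw [zz, mul_pow, ← Complex.exp_nat_mul, ← Complex.ofReal_pow, Complex.re_ofReal_mul]
  congr 1
  rw [← Complex.exp_ofReal_mul_I_re]
  congr 2
  push_cast
  ring

lemma VU_series {ρ : ℝ} (h0 : 0 < ρ) (h1 : ρ < 1) (x : ℝ) :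
    HasSum (fun n : ℕ => (2 * (-1) ^ n - 1) / ((n : ℝ) + 1) * ρ ^ (n + 1) * Real.cos (2 * ((n : ℝ) + 1) * x))
      ((UU (-zz ρ x)).re + 2 * (UU (zz ρ x)).re + 3 * Real.log 2) := by
  have hn : ‖zz ρ x‖ < 1 := by rw [zz_norm h0.le]; exact h1
  have s1 := Complex.hasSum_taylorSeries_log hn
  have s2 := Complex.hasSum_taylorSeries_neg_log hn
  have s3 := (s1.mul_left 2).sub s2
  have s4 := Complex.hasSum_re s3
  have s5 := (hasSum_nat_add_iff' 1).2 s4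
  refine hs_congr s5 (fun n => ?_) ?_
  · have e : (2 * ((-1 : ℂ) ^ (n + 1 + 1) * zz ρ x ^ (n + 1) / ((n + 1 : ℕ) : ℂ)) - zz ρ x ^ (n + 1) / ((n + 1 : ℕ) : ℂ))
        = (((2 * (-1) ^ n - 1) / ((n : ℝ) + 1) : ℝ) : ℂ) * zz ρ x ^ (n + 1) := by
      push_cast
      ring
    rw [e, Complex.re_ofReal_mul, zz_pow_re]
    push_cast
    ring
  · have e2 : (Complex.log 2).re = Real.log 2 := by
      rw [Complex.log_re]; simp
    simp [UU, ← sub_eq_add_neg, e2]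
    ring

lemma X3_series {ρ : ℝ} (h0 : 0 < ρ) (h1 : ρ < 1) :
    HasSum (fun n : ℕ => ρ ^ (n + 1) * (-(3 * π ^ 2 / 16) * (2 * (1 ^ n / ((n : ℝ) + 1) ^ 3) - (-1) ^ n / ((n : ℝ) + 1) ^ 3)
        + 3 / 8 * (1 ^ n / ((n : ℝ) + 1) ^ 5 + (-1) ^ n / ((n : ℝ) + 1) ^ 5)))
      ((∫ x in (0 : ℝ)..(π / 2), x ^ 3 * ((UU (-zz ρ x)).re + 2 * (UU (zz ρ x)).re)) + 3 * Real.log 2 * (π ^ 4 / 64)) := by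
  have hpi := Real.pi_pos
  have H := intervalIntegral.hasSum_integral_of_dominated_convergence (a := 0) (b := π / 2) (μ := volume)
    (F := fun (n : ℕ) (x : ℝ) => x ^ 3 * ((2 * (-1) ^ n - 1) / ((n : ℝ) + 1) * ρ ^ (n + 1) * Real.cos (2 * ((n : ℝ) + 1) * x)))
    (f := fun x => x ^ 3 * ((UU (-zz ρ x)).re + 2 * (UU (zz ρ x)).re + 3 * Real.log 2))
    (fun n _ => (π / 2) ^ 3 * (3 * ρ ^ n)) (fun n => (by fun_prop : Continuous _).aestronglyMeasurable) (fun n => Eventually.of_forall fun x hx => ?_)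
    (Eventually.of_forall fun x hx => ((summable_geometric_of_lt_one h0.le h1).mul_left 3).mul_left _)
    (by simp) (Eventually.of_forall fun x hx => (VU_series h0 h1 x).mul_left (x ^ 3))
  · refine hs_congr H (fun n => ?_) ?_
    · have := cn_val n
      have e : ∀ x : ℝ, x ^ 3 * ((2 * (-1) ^ n - 1) / ((n : ℝ) + 1) * ρ ^ (n + 1) * Real.cos (2 * ((n : ℝ) + 1) * x))
        = ((2 * (-1) ^ n - 1) / ((n : ℝ) + 1) * ρ ^ (n + 1)) * (x ^ 3 * Real.cos (2 * ((n : ℝ) + 1) * x)) := by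
        intro x; ring
      simp only [e]
      rw [intervalIntegral.integral_const_mul, this]
      have hn : (n : ℝ) + 1 ≠ 0 := by positivity
      have hsq : ((-1 : ℝ) ^ n) ^ 2 = 1 := by rw [← pow_mul, mul_comm, pow_mul]; norm_num
      generalize (-1 : ℝ) ^ n = e1 at hsq
      rw [one_pow]
      field_simp
      ring_nf
      simp only [hsq]
      ring
    · have e : ∀ x : ℝ, x ^ 3 * ((UU (-zz ρ x)).re + 2 * (UU (zz ρ x)).re + 3 * Real.log 2)
        = x ^ 3 * ((UU (-zz ρ x)).re + 2 * (UU (zz ρ x)).re) + 3 * Real.log 2 * x ^ 3 := by intro x; ring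
      simp only [e]
      rw [intervalIntegral.integral_add, intervalIntegral.integral_const_mul, integral_pow]
      · norm_num
        ring
      · apply Continuous.intervalIntegrable
        have c1 : Continuous fun x => UU (zz ρ x) := by
          refine continuous_iff_continuousAt.2 fun x => ?_
          have hn : ‖zz ρ x‖ < 1 := by rw [zz_norm h0.le]; exact h1
          exact ContinuousAt.comp (UU_diff hn).continuousAt (zz_cont ρ).continuousAt
        have c2 : Continuous fun x => UU (-zz ρ x) := by
          refine continuous_iff_continuousAt.2 fun x => ?_
          have hn : ‖zz ρ x‖ < 1 := by rw [zz_norm h0.le]; exact h1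
          exact ContinuousAt.comp (UU_neg_diff hn).continuousAt (zz_cont ρ).continuousAt
        have := Complex.continuous_re.comp c1
        have := Complex.continuous_re.comp c2
        fun_prop
      · apply Continuous.intervalIntegrable
        fun_prop
  · rw [uIoc_of_le (by positivity)] at hx
    have hx0 := hx.1.le
    rw [norm_mul, Real.norm_of_nonneg (by positivity)]
    refine mul_le_mul (pow_le_pow_left₀ hx0 hx.2 3) ?_ (norm_nonneg _) (by positivity)
    rw [norm_mul, norm_mul, norm_div, norm_pow, Real.norm_of_nonneg h0.le, Real.norm_of_nonneg (show (0 : ℝ) ≤ (n : ℝ) + 1 by positivity)]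
    have a1 : ‖(2 * (-1) ^ n - 1 : ℝ)‖ ≤ 3 := by
      rcases neg_one_pow_eq_or ℝ n with h | h <;> rw [h] <;> norm_num
    have a2 : ‖(2 * (-1) ^ n - 1 : ℝ)‖ / ((n : ℝ) + 1) ≤ 3 := by
      rw [div_le_iff₀ (by positivity)]
      have : (0 : ℝ) ≤ n := by positivity
      linarith
    have a3 : ρ ^ (n + 1) ≤ ρ ^ n := pow_le_pow_of_le_one h0.le h1.le (by omega)
    have a4 : ‖Real.cos (2 * ((n : ℝ) + 1) * x)‖ ≤ 1 := Real.abs_cos_le_one _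
    calc _ ≤ 3 * ρ ^ n * 1 := by gcongr
      _ = _ := by ring

lemma X3_limit : Tendsto (fun ρ => ∫ x in (0 : ℝ)..(π / 2), x ^ 3 * ((UU (-zz ρ x)).re + 2 * (UU (zz ρ x)).re)) (𝓝[<] 1)
    (𝓝 (93 / 128 * zetaVal 5 - 45 / 32 * zetaVal 2 * zetaVal 3 - 3 * Real.log 2 * (π ^ 4 / 64))) := by
  have s3 := zsum_summable 3 (by norm_num) 1 (by simp)
  have s3' := zsum_summable 3 (by norm_num) (-1) (by simp)
  have s5 := zsum_summable 5 (by norm_num) 1 (by simp)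
  have s5' := zsum_summable 5 (by norm_num) (-1) (by simp)
  have hsum : HasSum (fun n : ℕ => (-(3 * π ^ 2 / 16) * (2 * ((1 : ℝ) ^ n / ((n : ℝ) + 1) ^ 3) - (-1) ^ n / ((n : ℝ) + 1) ^ 3)
        + 3 / 8 * (1 ^ n / ((n : ℝ) + 1) ^ 5 + (-1) ^ n / ((n : ℝ) + 1) ^ 5))) (93 / 128 * zetaVal 5 - 45 / 32 * zetaVal 2 * zetaVal 3) := by
    have h3 := s3.hasSum
    have h3' := s3'.hasSum
    have h5 := s5.hasSum
    have h5' := s5'.hasSum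
    rw [zeta_tsum] at h3 h5
    rw [eta_tsum _ (by norm_num)] at h3' h5'
    have := (((h3.mul_left 2).sub h3').mul_left (-(3 * π ^ 2 / 16))).add ((h5.add h5').mul_left (3 / 8))
    refine hs_congr this (fun n => rfl) ?_
    rw [zeta2_val]
    ring
  have T := tendsto_tsum_of_dominated_convergence (𝓕 := 𝓝[<] (1 : ℝ))
    (f := fun (ρ : ℝ) (n : ℕ) => ρ ^ (n + 1) * (-(3 * π ^ 2 / 16) * (2 * ((1 : ℝ) ^ n / ((n : ℝ) + 1) ^ 3) - (-1) ^ n / ((n : ℝ) + 1) ^ 3)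
        + 3 / 8 * (1 ^ n / ((n : ℝ) + 1) ^ 5 + (-1) ^ n / ((n : ℝ) + 1) ^ 5)))
    (g := fun (n : ℕ) => (-(3 * π ^ 2 / 16) * (2 * ((1 : ℝ) ^ n / ((n : ℝ) + 1) ^ 3) - (-1) ^ n / ((n : ℝ) + 1) ^ 3)
        + 3 / 8 * (1 ^ n / ((n : ℝ) + 1) ^ 5 + (-1) ^ n / ((n : ℝ) + 1) ^ 5)))
    hsum.summable.norm
    (fun n => by
      have : Tendsto (fun ρ : ℝ => ρ ^ (n + 1)) (𝓝[<] 1) (𝓝 1) := by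
        have : Tendsto (fun ρ : ℝ => ρ ^ (n + 1)) (𝓝 1) (𝓝 (1 ^ (n + 1))) := (continuous_pow (n + 1)).tendsto 1
        rw [one_pow] at this
        exact this.mono_left nhdsWithin_le_nhds
      simpa only [one_mul] using this.mul_const _)
    (by
      filter_upwards [Ioo_mem_nhdsLT (zero_lt_one' ℝ)] with ρ hρ n
      rw [norm_mul]
      refine mul_le_of_le_one_left (norm_nonneg _) ?_
      rw [Real.norm_of_nonneg (pow_nonneg hρ.1.le _)]
      exact pow_le_one₀ hρ.1.le hρ.2.le)
  rw [hsum.tsum_eq] at T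
  refine (T.sub_const _).congr' ?_
  filter_upwards [Ioo_mem_nhdsLT (zero_lt_one' ℝ)] with ρ hρ
  rw [(X3_series hρ.1 hρ.2).tsum_eq]
  ring

lemma bd_plus {x : ℝ} (hx : x ∈ Ioo 0 (π / 2)) :
    1 + zz 1 x ∈ Complex.slitPlane ∧ UU (zz 1 x) = ⟨Real.log (Real.cos x), x⟩ := by
  have hc : 0 < Real.cos x := Real.cos_pos_of_mem_Ioo ⟨by linarith [hx.1, Real.pi_pos], hx.2⟩
  have e : 1 + zz 1 x = ((2 * Real.cos x : ℝ) : ℂ) * Complex.exp ((x : ℂ) * Complex.I) := by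
    have h2 : zz 1 x = Complex.exp ((x : ℂ) * Complex.I) * Complex.exp ((x : ℂ) * Complex.I) := by
      rw [zz, ← Complex.exp_add]
      push_cast
      ring_nf
    have h3 : Complex.exp (-((x : ℂ)) * Complex.I) * Complex.exp ((x : ℂ) * Complex.I) = 1 := by
      rw [← Complex.exp_add]; simp
    rw [h2]
    push_cast
    rw [Complex.two_cos]
    rw [add_mul, h3]
    ring
  have hl : Complex.log (1 + zz 1 x) = ((Real.log (2 * Real.cos x) : ℝ) : ℂ) + (x : ℂ) * Complex.I := by
    rw [e, Complex.log_ofReal_mul (by positivity) (Complex.exp_ne_zero _), Complex.log_exp]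
    · simp; linarith [hx.1, Real.pi_pos]
    · simp; linarith [hx.2, Real.pi_pos]
  constructor
  · left
    rw [e, Complex.re_ofReal_mul, Complex.exp_ofReal_mul_I_re]
    positivity
  · rw [UU, hl, Real.log_mul two_ne_zero hc.ne']
    apply Complex.ext <;> simp

lemma bd_minus {x : ℝ} (hx : x ∈ Ioo 0 (π / 2)) :
    1 + -zz 1 x ∈ Complex.slitPlane ∧ UU (-zz 1 x) = ⟨Real.log (Real.sin x), x - π / 2⟩ := by
  have hy : π / 2 - x ∈ Ioo 0 (π / 2) := ⟨by linarith [hx.2], by linarith [hx.1]⟩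
  obtain ⟨h1, h2⟩ := bd_plus hy
  have e : -zz 1 x = (starRingEnd ℂ) (zz 1 (π / 2 - x)) := by
    unfold zz
    rw [map_mul, ← Complex.exp_conj]
    simp only [Complex.ofReal_one, map_one, one_mul, map_mul, Complex.conj_ofReal, Complex.conj_I]
    rw [show ((2 * (π / 2 - x) : ℝ) : ℂ) * -Complex.I = -(π * Complex.I) + ((2 * x : ℝ) : ℂ) * Complex.I by push_cast; ring,
      Complex.exp_add, Complex.exp_neg, Complex.exp_pi_mul_I]
    norm_num
  have e2 : 1 + -zz 1 x = (starRingEnd ℂ) (1 + zz 1 (π / 2 - x)) := by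
    rw [e, map_add, map_one]
  have harg := Complex.slitPlane_arg_ne_pi h1
  constructor
  · rw [e2]
    rw [Complex.mem_slitPlane_iff] at h1 ⊢
    simpa using h1
  · rw [UU] at h2 ⊢
    rw [e2, Complex.log_conj _ harg, sub_eq_iff_eq_add.1 h2, Real.cos_pi_div_two_sub, map_add, Complex.conj_ofReal,
      add_sub_cancel_right]
    apply Complex.ext <;> simp

lemma key_identity {x : ℝ} (hx : x ∈ Ioo 0 (π / 2)) :
    (HH (zz 1 x)).im + x ^ 3 * ((UU (-zz 1 x)).re + 2 * (UU (zz 1 x)).re)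
      = 3 * (x * Real.log (Real.sin x) * (Real.log (Real.cos x)) ^ 2) := by
  rw [HH, (bd_plus hx).2, (bd_minus hx).2]
  generalize Real.log (Real.sin x) = b
  generalize Real.log (Real.cos x) = a
  have e : (⟨a, x⟩ : ℂ) ^ 4 / 4 = ((1 / 4 : ℝ) : ℂ) * (⟨a, x⟩ : ℂ) ^ 4 := by push_cast; ring
  rw [e]
  simp [pow_succ, Complex.mul_re, Complex.mul_im, -Complex.ofReal_div, -Complex.ofReal_inv, -one_div, -Complex.ofReal_ofNat]
  ring

lemma zz_cont_rho (x : ℝ) : Continuous (fun ρ => zz ρ x) := by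
  unfold zz
  fun_prop

lemma UU_cont {z : ℂ} (hz : 1 + z ∈ Complex.slitPlane) : ContinuousAt UU z := by
  unfold UU
  refine ContinuousAt.sub (ContinuousAt.clog ?_ hz) continuousAt_const
  fun_prop

lemma bd_limit {x : ℝ} (hx : x ∈ Ioo 0 (π / 2)) :
    Tendsto (fun ρ => (HH (zz ρ x)).im + x ^ 3 * ((UU (-zz ρ x)).re + 2 * (UU (zz ρ x)).re)) (𝓝[<] 1)
      (𝓝 (3 * (x * Real.log (Real.sin x) * (Real.log (Real.cos x)) ^ 2))) := by
  rw [← key_identity hx]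
  have c1 : ContinuousAt (fun ρ => UU (zz ρ x)) 1 :=
    ContinuousAt.comp (f := fun ρ => zz ρ x) (g := UU) (UU_cont (bd_plus hx).1) (zz_cont_rho x).continuousAt
  have c2 : ContinuousAt (fun ρ => UU (-zz ρ x)) 1 :=
    ContinuousAt.comp (f := fun ρ => -zz ρ x) (g := UU) (UU_cont (bd_minus hx).1) (zz_cont_rho x).neg.continuousAt
  have c3 : ContinuousAt (fun ρ => HH (zz ρ x)) 1 := by
    unfold HH
    fun_prop
  have r1 : ContinuousAt (fun ρ => (UU (zz ρ x)).re) 1 := Complex.continuous_re.continuousAt.comp c1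
  have r2 : ContinuousAt (fun ρ => (UU (-zz ρ x)).re) 1 := Complex.continuous_re.continuousAt.comp c2
  have r3 : ContinuousAt (fun ρ => (HH (zz ρ x)).im) 1 := Complex.continuous_im.continuousAt.comp c3
  have c : ContinuousAt (fun ρ => (HH (zz ρ x)).im + x ^ 3 * ((UU (-zz ρ x)).re + 2 * (UU (zz ρ x)).re)) 1 := by
    fun_prop
  exact c.tendsto.mono_left nhdsWithin_le_nhds

lemma log_norm_bound {w : ℂ} {s : ℝ} (hs : 0 < s) (h1 : s ≤ ‖w‖) (h2 : ‖w‖ ≤ 2) :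
    ‖Complex.log w - ((Real.log 2 : ℝ) : ℂ)‖ ≤ 6 + |Real.log s| := by
  have hw : 0 < ‖w‖ := hs.trans_le h1
  have l2 : Real.log 2 < 0.7 := by linarith [Real.log_two_lt_d9]
  have l2' : 0 < Real.log 2 := Real.log_pos (by norm_num)
  have hp := Real.pi_lt_d2
  have ha := Complex.abs_arg_le_pi w
  have a1 : |Real.log ‖w‖| ≤ Real.log 2 + |Real.log s| := by
    rw [abs_le]
    have b1 := Real.log_le_log hs h1
    have b2 := Real.log_le_log hw h2
    have b3 := neg_abs_le (Real.log s)
    have b4 := abs_nonneg (Real.log s)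
    constructor <;> linarith
  have a2 : ‖Complex.log w‖ ≤ |Real.log ‖w‖| + |Complex.arg w| := by
    have := Complex.norm_le_abs_re_add_abs_im (Complex.log w)
    rwa [Complex.log_re, Complex.log_im] at this
  have a3 : ‖((Real.log 2 : ℝ) : ℂ)‖ = Real.log 2 := by rw [Complex.norm_of_nonneg l2'.le]
  have := norm_sub_le (Complex.log w) ((Real.log 2 : ℝ) : ℂ)
  rw [a3] at this
  linarith

lemma sin_le_norm {ρ x : ℝ} (h0 : 0 ≤ ρ) (h1 : ρ ≤ 1) (hs : 0 ≤ Real.sin (2 * x)) :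
    (Real.sin (2 * x) ≤ ‖1 + zz ρ x‖ ∧ ‖1 + zz ρ x‖ ≤ 2) ∧ (Real.sin (2 * x) ≤ ‖1 + -zz ρ x‖ ∧ ‖1 + -zz ρ x‖ ≤ 2) := by
  have hz : zz ρ x = ⟨ρ * Real.cos (2 * x), ρ * Real.sin (2 * x)⟩ := by
    apply Complex.ext
    · rw [zz, Complex.re_ofReal_mul, Complex.exp_ofReal_mul_I_re]
    · rw [zz, Complex.im_ofReal_mul, Complex.exp_ofReal_mul_I_im]
  have hsc := Real.sin_sq_add_cos_sq (2 * x)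
  refine ⟨⟨?_, ?_⟩, ⟨?_, ?_⟩⟩
  · refine (sq_le_sq₀ hs (norm_nonneg _)).1 ?_
    rw [Complex.sq_norm, Complex.normSq_apply, hz]
    simp
    nlinarith [sq_nonneg (ρ + Real.cos (2 * x))]
  · have := norm_add_le (1 : ℂ) (zz ρ x)
    rw [zz_norm h0, norm_one] at this
    linarith
  · refine (sq_le_sq₀ hs (norm_nonneg _)).1 ?_
    rw [Complex.sq_norm, Complex.normSq_apply, hz]
    simp
    nlinarith [sq_nonneg (ρ - Real.cos (2 * x))]
  · have := norm_add_le (1 : ℂ) (-zz ρ x)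
    rw [norm_neg, zz_norm h0, norm_one] at this
    linarith

lemma sin2_pos {x : ℝ} (hx : x ∈ Ioo 0 (π / 2)) : 0 < Real.sin (2 * x) :=
  Real.sin_pos_of_pos_of_lt_pi (by linarith [hx.1]) (by linarith [hx.2])

lemma K_bound {ρ x : ℝ} (h0 : 0 ≤ ρ) (h1 : ρ ≤ 1) (hx : x ∈ Ioo 0 (π / 2)) :
    ‖(HH (zz ρ x)).im + x ^ 3 * ((UU (-zz ρ x)).re + 2 * (UU (zz ρ x)).re)‖ ≤ 4 * (6 + |Real.log (Real.sin (2 * x))|) ^ 4 := by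
  have hs := sin2_pos hx
  obtain ⟨⟨a1, a2⟩, a3, a4⟩ := sin_le_norm h0 h1 hs.le
  have u : ‖UU (zz ρ x)‖ ≤ _ := log_norm_bound hs a1 a2
  have v : ‖UU (-zz ρ x)‖ ≤ _ := log_norm_bound hs a3 a4
  obtain ⟨M, hM⟩ : ∃ M, M = 6 + |Real.log (Real.sin (2 * x))| := ⟨_, rfl⟩
  rw [← hM] at u v ⊢
  have hM6 : 6 ≤ M := by rw [hM]; linarith [abs_nonneg (Real.log (Real.sin (2 * x)))]
  have hpi := Real.pi_lt_d2
  have hH : ‖HH (zz ρ x)‖ ≤ M ^ 3 * M + M ^ 4 / 4 + 2 * M ^ 3 := by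
    unfold HH
    have b1 : ‖UU (zz ρ x) ^ 3 * UU (-zz ρ x)‖ ≤ M ^ 3 * M := by
      rw [norm_mul, norm_pow]; gcongr
    have b2 : ‖UU (zz ρ x) ^ 4 / 4‖ ≤ M ^ 4 / 4 := by
      rw [norm_div, norm_pow, Complex.norm_ofNat]; gcongr
    have b3 : ‖Complex.I * ((π / 2 : ℝ) : ℂ) * UU (zz ρ x) ^ 3‖ ≤ 2 * M ^ 3 := by
      rw [norm_mul, norm_pow, norm_mul, Complex.norm_I, one_mul, Complex.norm_of_nonneg (by positivity)]
      have : π / 2 ≤ 2 := by linarith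
      gcongr
    refine (norm_add_le _ _).trans (add_le_add ((norm_sub_le _ _).trans (add_le_add b1 b2)) b3)
  have c1 := (Complex.abs_im_le_norm (HH (zz ρ x))).trans hH
  have c2 := (Complex.abs_re_le_norm _).trans u
  have c3 := (Complex.abs_re_le_norm _).trans v
  have x3 : |x ^ 3| ≤ 8 := by
    rw [abs_of_nonneg (pow_nonneg hx.1.le 3)]
    have : x ≤ 2 := by linarith [hx.2]
    calc x ^ 3 ≤ 2 ^ 3 := pow_le_pow_left₀ hx.1.le this 3
      _ = 8 := by norm_num
  have c4 : |(UU (-zz ρ x)).re + 2 * (UU (zz ρ x)).re| ≤ 3 * M := by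
    rw [abs_le] at c2 c3 ⊢
    constructor <;> linarith
  have c5 : |x ^ 3 * ((UU (-zz ρ x)).re + 2 * (UU (zz ρ x)).re)| ≤ 8 * (3 * M) := by
    rw [abs_mul]
    exact mul_le_mul x3 c4 (abs_nonneg _) (by norm_num)
  rw [Real.norm_eq_abs]
  refine (abs_add_le _ _).trans ((add_le_add c1 c5).trans ?_)
  have m3 : 6 * M ^ 3 ≤ M ^ 4 := by
    rw [pow_succ M 3, mul_comm]
    gcongr
  have m2 : 36 * M ≤ M ^ 3 := by nlinarith [mul_self_nonneg (M - 6), mul_nonneg (by linarith : 0 ≤ M) (mul_self_nonneg (M - 6))]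
  have : 0 ≤ M ^ 4 := by positivity
  nlinarith

lemma bound_integrable : IntervalIntegrable (fun x => 4 * (6 + |Real.log (Real.sin (2 * x))|) ^ 4) volume 0 (π / 2) := by
  have hpi := Real.pi_pos
  have l1 : IntervalIntegrable (fun s : ℝ => |Real.log s| ^ 4) volume 0 1 :=
    (Ioo_intervalIntegrable zero_le_one).2 (log_pow_integrable 4)
  have l2 : IntervalIntegrable (fun s : ℝ => |Real.log (1 - s)| ^ 4) volume 0 1 := by
    have := (l1.comp_sub_left 1).symm
    simpa using this
  have hg : IntervalIntegrable (fun s : ℝ => 4 * (8 * (6 ^ 4 + 8 * (|Real.log s| ^ 4 + |Real.log (1 - s)| ^ 4)))) volume 0 1 :=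
    ((intervalIntegrable_const.add ((l1.add l2).const_mul 8)).const_mul 8).const_mul 4
  have hf : IntervalIntegrable (fun s : ℝ => 4 * (6 + |Real.log (Real.sin (π * s))|) ^ 4) volume 0 1 := by
    rw [Ioo_intervalIntegrable zero_le_one] at hg ⊢
    refine Integrable.mono' hg ((by fun_prop : Measurable _).aestronglyMeasurable) ?_
    refine (ae_restrict_iff' measurableSet_Ioo).2 (Eventually.of_forall fun s hs => ?_)
    have h0 := hs.1
    have h1 := hs.2
    rw [Real.norm_of_nonneg (by positivity)]
    have hs1 : s ≤ Real.sin (π * s / 2) := by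
      have := Real.mul_le_sin (x := π * s / 2) (by positivity) (by nlinarith)
      have e : 2 / π * (π * s / 2) = s := by field_simp
      rwa [e] at this
    have hs2 : 1 - s ≤ Real.cos (π * s / 2) := by
      have := Real.mul_le_sin (x := π / 2 - π * s / 2) (by nlinarith) (by nlinarith)
      have e : 2 / π * (π / 2 - π * s / 2) = 1 - s := by field_simp
      rwa [e, Real.sin_pi_div_two_sub] at this
    have hlow : s * (1 - s) ≤ Real.sin (π * s) := by
      rw [show π * s = 2 * (π * s / 2) by ring, Real.sin_two_mul]
      have : s * (1 - s) ≤ Real.sin (π * s / 2) * Real.cos (π * s / 2) :=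
        mul_le_mul hs1 hs2 (by linarith) (by linarith)
      have : 0 ≤ s * (1 - s) := mul_nonneg h0.le (by linarith)
      linarith
    have hpos : 0 < s * (1 - s) := mul_pos h0 (by linarith)
    have hlog := Real.log_le_log hpos hlow
    rw [Real.log_mul h0.ne' (by linarith)] at hlog
    have hlog2 : Real.log (Real.sin (π * s)) ≤ 0 := Real.log_nonpos (by linarith) (Real.sin_le_one _)
    have habs : |Real.log (Real.sin (π * s))| ≤ |Real.log s| + |Real.log (1 - s)| := by
      rw [abs_of_nonpos hlog2]
      linarith [neg_abs_le (Real.log s), neg_abs_le (Real.log (1 - s))]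
    have p1 := add_pow_le (abs_nonneg (Real.log s)) (abs_nonneg (Real.log (1 - s))) 4
    have p2 := add_pow_le (show (0 : ℝ) ≤ 6 by norm_num) (by positivity : 0 ≤ |Real.log s| + |Real.log (1 - s)|) 4
    have p3 : (6 + |Real.log (Real.sin (π * s))|) ^ 4 ≤ (6 + (|Real.log s| + |Real.log (1 - s)|)) ^ 4 := by gcongr
    norm_num at p1 p2 ⊢
    linarith
  have := hf.comp_mul_left (c := 2 / π)
  have e : ∀ x, π * (2 / π * x) = 2 * x := by intro x; field_simp
  simp only [e, zero_div, one_div_div] at this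
  exact this

lemma main_eq : 3 * ∫ x in (0 : ℝ)..(π / 2), x * Real.log (Real.sin x) * (Real.log (Real.cos x)) ^ 2
    = (- (π ^ 2 / 4) * Real.log 2 ^ 3 + 1 / 2 * ∫ r in (0 : ℝ)..1, (FF r - FF (-r)) / r)
      + (93 / 128 * zetaVal 5 - 45 / 32 * zetaVal 2 * zetaVal 3 - 3 * Real.log 2 * (π ^ 4 / 64)) := by
  have hpi := Real.pi_pos
  have cU : ∀ ρ ∈ Ioo (0 : ℝ) 1, Continuous fun x => UU (zz ρ x) := by
    intro ρ hρ
    refine continuous_iff_continuousAt.2 fun x => ?_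
    have hn : ‖zz ρ x‖ < 1 := by rw [zz_norm hρ.1.le]; exact hρ.2
    exact ContinuousAt.comp (UU_diff hn).continuousAt (zz_cont ρ).continuousAt
  have cV : ∀ ρ ∈ Ioo (0 : ℝ) 1, Continuous fun x => UU (-zz ρ x) := by
    intro ρ hρ
    refine continuous_iff_continuousAt.2 fun x => ?_
    have hn : ‖zz ρ x‖ < 1 := by rw [zz_norm hρ.1.le]; exact hρ.2
    exact ContinuousAt.comp (UU_neg_diff hn).continuousAt (zz_cont ρ).continuousAt
  have k1 : ∀ ρ ∈ Ioo (0 : ℝ) 1, Continuous fun x => (HH (zz ρ x)).im := by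
    intro ρ hρ
    have h1 := cU ρ hρ
    have h2 := cV ρ hρ
    refine Complex.continuous_im.comp ?_
    unfold HH
    fun_prop
  have k2 : ∀ ρ ∈ Ioo (0 : ℝ) 1, Continuous fun x => x ^ 3 * ((UU (-zz ρ x)).re + 2 * (UU (zz ρ x)).re) := by
    intro ρ hρ
    have h1 := Complex.continuous_re.comp (cU ρ hρ)
    have h2 := Complex.continuous_re.comp (cV ρ hρ)
    fun_prop
  have T1 : Tendsto (fun ρ => ∫ x in (0 : ℝ)..(π / 2), ((HH (zz ρ x)).im + x ^ 3 * ((UU (-zz ρ x)).re + 2 * (UU (zz ρ x)).re))) (𝓝[<] 1)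
      (𝓝 (∫ x in (0 : ℝ)..(π / 2), 3 * (x * Real.log (Real.sin x) * (Real.log (Real.cos x)) ^ 2))) := by
    have hne : ∀ᵐ x : ℝ, x ≠ π / 2 := by
      simp [ae_iff, measure_singleton]
    have hmem : ∀ x : ℝ, x ≠ π / 2 → x ∈ uIoc 0 (π / 2) → x ∈ Ioo 0 (π / 2) := by
      intro x h1 h2
      rw [uIoc_of_le (by positivity)] at h2
      exact ⟨h2.1, lt_of_le_of_ne h2.2 h1⟩
    refine intervalIntegral.tendsto_integral_filter_of_dominated_convergence _ ?_ ?_ bound_integrable ?_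
    · filter_upwards [Ioo_mem_nhdsLT (zero_lt_one' ℝ)] with ρ hρ
      exact ((k1 ρ hρ).add (k2 ρ hρ)).aestronglyMeasurable
    · filter_upwards [Ioo_mem_nhdsLT (zero_lt_one' ℝ)] with ρ hρ
      filter_upwards [hne] with x hx hx2
      exact K_bound hρ.1.le hρ.2.le (hmem x hx hx2)
    · filter_upwards [hne] with x hx hx2
      exact bd_limit (hmem x hx hx2)
  have T2 : Tendsto (fun ρ => ∫ r in (0 : ℝ)..ρ, (FF r - FF (-r)) / r) (𝓝[<] 1) (𝓝 (∫ r in (0 : ℝ)..1, (FF r - FF (-r)) / r)) := by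
    have hI : IntegrableOn (fun r => (FF r - FF (-r)) / r) (uIcc 0 1) := by
      rw [uIcc_of_le zero_le_one, integrableOn_Icc_iff_integrableOn_Ioo]
      exact FF_val.1
    have hc := intervalIntegral.continuousOn_primitive_interval hI
    have := (hc 1 right_mem_uIcc).tendsto
    refine this.mono_left ?_
    rw [← nhdsWithin_Ioo_eq_nhdsLT (zero_lt_one' ℝ), uIcc_of_le zero_le_one]
    exact nhdsWithin_mono _ Ioo_subset_Icc_self
  have T3 := ((T2.const_mul (1 / 2)).const_add (- (π ^ 2 / 4) * Real.log 2 ^ 3)).add X3_limit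
  have T4 := T3.congr' (f₂ := fun ρ => ∫ x in (0 : ℝ)..(π / 2), ((HH (zz ρ x)).im + x ^ 3 * ((UU (-zz ρ x)).re + 2 * (UU (zz ρ x)).re))) (by
    filter_upwards [Ioo_mem_nhdsLT (zero_lt_one' ℝ)] with ρ hρ
    rw [intervalIntegral.integral_add ((k1 ρ hρ).intervalIntegrable _ _) ((k2 ρ hρ).intervalIntegrable _ _), contour hρ.1 hρ.2])
  rw [← intervalIntegral.integral_const_mul]
  exact tendsto_nhds_unique T1 T4


end

theorem stmt_8 :
    ∫ x in (0 : ℝ)..(π / 2), x * Real.log (Real.sin x) * (Real.log (Real.cos x)) ^ 2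
    = 155 / 128 * zetaVal 5 + 13 / 32 * zetaVal 2 * zetaVal 3 - polyLog 5 (1 / 2)
      - 49 / 32 * Real.log 2 * zetaVal 4 - 5 / 6 * Real.log 2 ^ 3 * zetaVal 2 + 1 / 120 * Real.log 2 ^ 5 := by
  have h := main_eq
  rw [← Ioo_to_interval zero_le_one, FF_val.2] at h
  have z2 := zeta2_val
  have z4 := zeta4_val
  have p2 : π ^ 2 = 6 * zetaVal 2 := by rw [z2]; ring
  have p4 : π ^ 4 = 90 * zetaVal 4 := by rw [z4]; ring
  rw [p2, p4] at h
  linarith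
end
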